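/- arXiv:1904.10848 — 3 statements merged into one kernel-verified Lean document; each statement's English description precedes it below -/
import Mathlib

section
/- Let V₈ = ℂ⁸ with standard basis v₁,…,v₈ and let y₄ := v₄∧v₅∧v₆ + v₁∧v₄∧v₇ + v₂∧v₅∧v₇ + v₂∧v₆∧v₈ + v₃∧v₅∧v₈ + v₃∧v₆∧v₇ ∈ ⋀³V₈. For every g ∈ GL(V₈), setting y := (⋀³g)(y₄), there exist exactly three pairs of subspaces (U₄, U₆) with dim U₄ = 4, dim U₆ = 6 and U₄ ⊆ U₆ ⊆ V₈ such that y ∈ ⋀²U₄∧V₈ + ⋀³U₆. Moreover, for g = id these three pairs are: (span{v₅,v₆,v₇,v₈}, span{v₁,v₄,v₅,v₆,v₇,v₈}), (span{v₄,v₅−v₆,v₇,v₈}, span{v₂+v₃,v₄,v₅,v₆,v₇,v₈}), and (span{v₄,v₅+v₆,v₇,v₈}, span{v₂−v₃,v₄,v₅,v₆,v₇,v₈}). -/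
open ExteriorAlgebra

noncomputable section

/-- `V₈ = ℂ⁸`. -/
abbrev V8 : Type := Fin 8 → ℂ

/-- The standard basis vectors of `ℂ⁸`; `v i` corresponds to `v_{i+1}` of the paper. -/
def v (i : Fin 8) : V8 := Pi.single i 1

/-- For subspaces `S, T, U` of `W = ℂ⁸`, the subspace `S∧T∧U` of `⋀³W`, realized as the span,
inside the exterior algebra, of all products `s∧t∧u` with `s ∈ S`, `t ∈ T`, `u ∈ U`.
In particular `wSpan S S ⊤ = ⋀²S∧W` and `wSpan S S S = ⋀³S`. -/
def wSpan (S T U : Submodule ℂ V8) : Submodule ℂ (ExteriorAlgebra ℂ V8) :=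
  Submodule.span ℂ {x | ∃ s ∈ S, ∃ t ∈ T, ∃ u ∈ U, x = ι ℂ s * ι ℂ t * ι ℂ u}

/-- The representative `y₄ = v₄∧v₅∧v₆ + v₁∧v₄∧v₇ + v₂∧v₅∧v₇ + v₂∧v₆∧v₈ + v₃∧v₅∧v₈ + v₃∧v₆∧v₇`
of the open orbit of the orbit closure `Y₄ ⊂ ⋀³ℂ⁸` (with 0-based indices). -/
def y4 : ExteriorAlgebra ℂ V8 :=
  ι ℂ (v 3) * ι ℂ (v 4) * ι ℂ (v 5) + ι ℂ (v 0) * ι ℂ (v 3) * ι ℂ (v 6) +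
  ι ℂ (v 1) * ι ℂ (v 4) * ι ℂ (v 6) + ι ℂ (v 1) * ι ℂ (v 5) * ι ℂ (v 7) +
  ι ℂ (v 2) * ι ℂ (v 4) * ι ℂ (v 7) + ι ℂ (v 2) * ι ℂ (v 5) * ι ℂ (v 6)

/-- The set of pairs `(U₄, U₆)` with `dim U₄ = 4`, `dim U₆ = 6`, `U₄ ⊆ U₆` and
`y ∈ ⋀²U₄∧V₈ + ⋀³U₆`. -/
def pairsY4 (y : ExteriorAlgebra ℂ V8) : Set (Submodule ℂ V8 × Submodule ℂ V8) :=
  {P | Module.finrank ℂ P.1 = 4 ∧ Module.finrank ℂ P.2 = 6 ∧ P.1 ≤ P.2 ∧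
    y ∈ wSpan P.1 P.1 ⊤ ⊔ wSpan P.2 P.2 P.2}

section LinearSystem

variable {W : Type*} [AddCommGroup W] [Module ℂ W]

/-- If `n` functionals separate the points of an `n`-dimensional subspace `B`, they take
arbitrary prescribed values on `B`. -/
lemma exists_mem_forall_apply_eq [FiniteDimensional ℂ W] {n : ℕ} {B : Submodule ℂ W}
    (hB : Module.finrank ℂ B = n) (f : Fin n → W →ₗ[ℂ] ℂ)
    (hf : ∀ b ∈ B, (∀ i, f i b = 0) → b = 0) (t : Fin n → ℂ) :
    ∃ b ∈ B, ∀ i, f i b = t i := by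
  let F : B →ₗ[ℂ] (Fin n → ℂ) := (LinearMap.pi f).comp B.subtype
  have hinj : Function.Injective F := by
    rw [← LinearMap.ker_eq_bot, LinearMap.ker_eq_bot']
    intro b hb
    exact Subtype.ext (hf b b.2 fun i => congrFun hb i)
  have hsurj : Function.Surjective F :=
    (LinearMap.injective_iff_surjective_of_finrank_eq_finrank (by simp [hB])).1 hinj
  obtain ⟨b, hb⟩ := hsurj t
  exact ⟨b, b.2, fun i => congrFun hb i⟩

/-- `A ⊆ B` are subspaces of dimensions 2 and 4 on which the contraction
`(a, b) ↦ y(a, b, ·)` vanishes, where `y = x₁∧x₂∧x₃ + ∑ zᵢ∧xᵢ∧pᵢ` and `p₁ + p₂ + p₃ = 0`. -/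
structure IsotropicPair (A B : Submodule ℂ W) (x₁ x₂ x₃ z₁ z₂ z₃ p₁ p₂ p₃ : W →ₗ[ℂ] ℂ) :
    Prop where
  finrank_left : Module.finrank ℂ A = 2
  finrank_right : Module.finrank ℂ B = 4
  le : A ≤ B
  eq_zero : ∀ w, x₁ w = 0 → x₂ w = 0 → x₃ w = 0 → z₁ w = 0 → z₂ w = 0 → z₃ w = 0 →
    p₁ w = 0 → p₂ w = 0 → p₃ w = 0 → w = 0
  sum_eq : ∀ w, p₁ w + p₂ w + p₃ w = 0
  coeff_x₁ : ∀ a ∈ A, ∀ b ∈ B, x₂ a * x₃ b - x₃ a * x₂ b + p₁ a * z₁ b - z₁ a * p₁ b = 0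
  coeff_x₂ : ∀ a ∈ A, ∀ b ∈ B, x₃ a * x₁ b - x₁ a * x₃ b + p₂ a * z₂ b - z₂ a * p₂ b = 0
  coeff_x₃ : ∀ a ∈ A, ∀ b ∈ B, x₁ a * x₂ b - x₂ a * x₁ b + p₃ a * z₃ b - z₃ a * p₃ b = 0
  coeff_z₁ : ∀ a ∈ A, ∀ b ∈ B, x₁ a * p₁ b = p₁ a * x₁ b
  coeff_z₂ : ∀ a ∈ A, ∀ b ∈ B, x₂ a * p₂ b = p₂ a * x₂ b
  coeff_z₃ : ∀ a ∈ A, ∀ b ∈ B, x₃ a * p₃ b = p₃ a * x₃ b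
  coeff_p₁₂ : ∀ a ∈ A, ∀ b ∈ B, z₁ a * x₁ b - x₁ a * z₁ b = z₂ a * x₂ b - x₂ a * z₂ b
  coeff_p₂₃ : ∀ a ∈ A, ∀ b ∈ B, z₂ a * x₂ b - x₂ a * z₂ b = z₃ a * x₃ b - x₃ a * z₃ b

namespace IsotropicPair

variable {A B : Submodule ℂ W} {x₁ x₂ x₃ z₁ z₂ z₃ p₁ p₂ p₃ : W →ₗ[ℂ] ℂ}

lemma rotate (h : IsotropicPair A B x₁ x₂ x₃ z₁ z₂ z₃ p₁ p₂ p₃) :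
    IsotropicPair A B x₂ x₃ x₁ z₂ z₃ z₁ p₂ p₃ p₁ where
  finrank_left := h.finrank_left
  finrank_right := h.finrank_right
  le := h.le
  eq_zero w a b c d e f g i j := h.eq_zero w c a b f d e j g i
  sum_eq w := by linear_combination h.sum_eq w
  coeff_x₁ := h.coeff_x₂
  coeff_x₂ := h.coeff_x₃
  coeff_x₃ := h.coeff_x₁
  coeff_z₁ := h.coeff_z₂
  coeff_z₂ := h.coeff_z₃
  coeff_z₃ := h.coeff_z₁
  coeff_p₁₂ := h.coeff_p₂₃
  coeff_p₂₃ a ha b hb := ((h.coeff_p₁₂ a ha b hb).trans (h.coeff_p₂₃ a ha b hb)).symm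

variable [FiniteDimensional ℂ W]

lemma exists_left_ne_zero (h : IsotropicPair A B x₁ x₂ x₃ z₁ z₂ z₃ p₁ p₂ p₃)
    (f : W →ₗ[ℂ] ℂ) : ∃ a ∈ A, f a = 0 ∧ a ≠ 0 := by
  by_contra! H
  obtain ⟨a, -, ha⟩ := exists_mem_forall_apply_eq h.finrank_left ![f, 0]
    (fun b hb hf => H b hb (hf 0)) ![0, 1]
  simpa using ha 1

lemma exists_right_ne_zero (h : IsotropicPair A B x₁ x₂ x₃ z₁ z₂ z₃ p₁ p₂ p₃)
    (f g k : W →ₗ[ℂ] ℂ) : ∃ b ∈ B, f b = 0 ∧ g b = 0 ∧ k b = 0 ∧ b ≠ 0 := by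
  by_contra! H
  obtain ⟨a, -, ha⟩ := exists_mem_forall_apply_eq h.finrank_right ![f, g, k, 0]
    (fun b hb hf => H b hb (hf 0) (hf 1) (hf 2)) ![0, 0, 0, 1]
  simpa using ha 3

lemma p₃_eq_zero_of_ne (h : IsotropicPair A B x₁ x₂ x₃ z₁ z₂ z₃ p₁ p₂ p₃)
    {a : W} (ha : a ∈ A) (h₁ : p₁ a ≠ 0) (h₂ : p₂ a ≠ 0) : p₃ a = 0 := by
  by_contra h₃
  obtain ⟨b, hb, e₁, e₂, -, hne⟩ := h.exists_right_ne_zero p₁ p₂ 0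
  have e₃ : p₃ b = 0 := by linear_combination h.sum_eq b - e₁ - e₂
  have f₁ : x₁ b = 0 := by simpa [e₁, h₁] using h.coeff_z₁ a ha b hb
  have f₂ : x₂ b = 0 := by simpa [e₂, h₂] using h.coeff_z₂ a ha b hb
  have f₃ : x₃ b = 0 := by simpa [e₃, h₃] using h.coeff_z₃ a ha b hb
  refine hne (h.eq_zero b f₁ f₂ f₃ ?_ ?_ ?_ e₁ e₂ e₃)
  · simpa [e₁, f₂, f₃, h₁] using h.coeff_x₁ a ha b hb
  · simpa [e₂, f₁, f₃, h₂] using h.coeff_x₂ a ha b hb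
  · simpa [e₃, f₁, f₂, h₃] using h.coeff_x₃ a ha b hb

lemma p₁_eq_zero_of_p₃_eq_zero (h : IsotropicPair A B x₁ x₂ x₃ z₁ z₂ z₃ p₁ p₂ p₃)
    {a : W} (ha : a ∈ A) (h₃ : p₃ a = 0) : p₁ a = 0 := by
  by_contra h₁
  have h₂ : p₂ a ≠ 0 := fun h₂ => h₁ (by linear_combination h.sum_eq a - h₂ - h₃)
  obtain ⟨b, hb, hbt⟩ := exists_mem_forall_apply_eq h.finrank_right ![p₁, p₂, x₃, z₃]
    (by
      intro b hb hf
      have e₁ : p₁ b = 0 := hf 0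
      have e₂ : p₂ b = 0 := hf 1
      have e₃ : p₃ b = 0 := by linear_combination h.sum_eq b - e₁ - e₂
      have f₁ : x₁ b = 0 := by simpa [e₁, h₁] using h.coeff_z₁ a ha b hb
      have f₂ : x₂ b = 0 := by simpa [e₂, h₂] using h.coeff_z₂ a ha b hb
      have f₃ : x₃ b = 0 := hf 2
      refine h.eq_zero b f₁ f₂ f₃ ?_ ?_ (hf 3) e₁ e₂ e₃
      · simpa [e₁, f₂, f₃, h₁] using h.coeff_x₁ a ha b hb
      · simpa [e₂, f₁, f₃, h₂] using h.coeff_x₂ a ha b hb) ![-1, 0, 0, 0]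
  have b₁ : p₁ b = -1 := hbt 0
  have b₂ : p₂ b = 0 := hbt 1
  have b₃ : p₃ b = 1 := by linear_combination h.sum_eq b - b₁ - b₂
  obtain ⟨a', ha', e₁, e₂, hne⟩ : ∃ a' ∈ A, p₁ a' = 0 ∧ p₂ a' = 0 ∧ a' ≠ 0 := by
    by_contra! H
    obtain ⟨c, hc, hct⟩ := exists_mem_forall_apply_eq h.finrank_left ![p₁, p₂]
      (fun b hb hf => H b hb (hf 0) (hf 1)) ![1, 1]
    have c₁ : p₁ c = 1 := hct 0
    have c₂ : p₂ c = 1 := hct 1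
    have c₃ := h.p₃_eq_zero_of_ne hc (by simp [c₁]) (by simp [c₂])
    have := h.sum_eq c
    norm_num [c₁, c₂, c₃] at this
  have e₃ : p₃ a' = 0 := by linear_combination h.sum_eq a' - e₁ - e₂
  have f₁ : x₁ a' = 0 := by simpa [e₁, h₁] using h.coeff_z₁ a ha a' (h.le ha')
  have f₂ : x₂ a' = 0 := by simpa [e₂, h₂] using h.coeff_z₂ a ha a' (h.le ha')
  have f₃ : x₃ a' = 0 := by simpa [e₃, b₃] using h.coeff_z₃ a' ha' b hb
  refine hne (h.eq_zero a' f₁ f₂ f₃ ?_ ?_ ?_ e₁ e₂ e₃)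
  · simpa [e₁, f₂, f₃, h₁] using h.coeff_x₁ a ha a' (h.le ha')
  · simpa [e₂, f₁, f₃, h₂] using h.coeff_x₂ a ha a' (h.le ha')
  · simpa [e₃, f₁, f₂, b₃] using h.coeff_x₃ a' ha' b hb

lemma p₁_left_eq_zero (h : IsotropicPair A B x₁ x₂ x₃ z₁ z₂ z₃ p₁ p₂ p₃)
    {a : W} (ha : a ∈ A) : p₁ a = 0 := by
  by_contra h₁
  by_cases h₂ : p₂ a = 0
  · have h₃ := h.rotate.rotate.p₁_eq_zero_of_p₃_eq_zero ha h₂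
    exact h₁ (by linear_combination h.sum_eq a - h₂ - h₃)
  · exact h₁ (h.p₁_eq_zero_of_p₃_eq_zero ha (h.p₃_eq_zero_of_ne ha h₁ h₂))

lemma x₁_left_eq_zero (h : IsotropicPair A B x₁ x₂ x₃ z₁ z₂ z₃ p₁ p₂ p₃)
    {a : W} (ha : a ∈ A) : x₁ a = 0 := by
  by_contra h₁
  have q₁ : ∀ c ∈ A, p₁ c = 0 := fun c hc => h.p₁_left_eq_zero hc
  have q₂ : ∀ c ∈ A, p₂ c = 0 := fun c hc => h.rotate.p₁_left_eq_zero hc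
  have q₃ : ∀ c ∈ A, p₃ c = 0 := fun c hc => h.rotate.rotate.p₁_left_eq_zero hc
  have r₁ : ∀ b ∈ B, p₁ b = 0 := fun b hb => by
    simpa [h₁, q₁ a ha] using h.coeff_z₁ a ha b hb
  by_cases H : ∀ b ∈ B, p₂ b = 0
  · have r₃ : ∀ b ∈ B, p₃ b = 0 := fun b hb => by
      linear_combination h.sum_eq b - r₁ b hb - H b hb
    obtain ⟨b, hb, hbt⟩ := exists_mem_forall_apply_eq h.finrank_right ![x₁, z₁, z₂, z₃]
      (by
        intro b hb hf
        have e₁ : x₁ b = 0 := hf 0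
        refine h.eq_zero b e₁ ?_ ?_ (hf 1) (hf 2) (hf 3) (r₁ b hb) (H b hb) (r₃ b hb)
        · simpa [e₁, h₁, q₃ a ha, r₃ b hb] using h.coeff_x₃ a ha b hb
        · simpa [e₁, h₁, q₂ a ha, H b hb] using h.coeff_x₂ a ha b hb) ![0, 1, 0, 0]
    have e₁ : x₁ b = 0 := hbt 0
    have f₁ : z₁ b = 1 := hbt 1
    have f₂ : z₂ b = 0 := hbt 2
    have e₂ : x₂ b = 0 := by
      simpa [e₁, h₁, q₃ a ha, r₃ b hb] using h.coeff_x₃ a ha b hb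
    exact h₁ (by simpa [e₁, e₂, f₁, f₂] using h.coeff_p₁₂ a ha b hb)
  · push Not at H
    obtain ⟨b, hb, hb₂⟩ := H
    have hb₃ : p₃ b ≠ 0 := fun e => hb₂ (by linear_combination h.sum_eq b - r₁ b hb - e)
    have h₂ : x₂ a = 0 := by simpa [hb₂, q₂ a ha] using h.coeff_z₂ a ha b hb
    obtain ⟨c, hc, e₁, hne⟩ := h.exists_left_ne_zero x₁
    have e₂ : x₂ c = 0 := by simpa [hb₂, q₂ c hc] using h.coeff_z₂ c hc b hb
    have e₃ : x₃ c = 0 := by simpa [hb₃, q₃ c hc] using h.coeff_z₃ c hc b hb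
    refine hne (h.eq_zero c e₁ e₂ e₃ ?_ ?_ ?_ (q₁ c hc) (q₂ c hc) (q₃ c hc))
    · simpa [e₁, e₂, h₁, h₂] using h.coeff_p₁₂ a ha c (h.le hc)
    · simpa [e₁, e₃, hb₂, q₂ c hc] using h.coeff_x₂ c hc b hb
    · simpa [e₁, e₂, hb₃, q₃ c hc] using h.coeff_x₃ c hc b hb

lemma left_eq_zero (h : IsotropicPair A B x₁ x₂ x₃ z₁ z₂ z₃ p₁ p₂ p₃) {a : W} (ha : a ∈ A)
    (h₁ : z₁ a = 0) (h₂ : z₂ a = 0) (h₃ : z₃ a = 0) : a = 0 :=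
  h.eq_zero a (h.x₁_left_eq_zero ha) (h.rotate.x₁_left_eq_zero ha)
    (h.rotate.rotate.x₁_left_eq_zero ha) h₁ h₂ h₃ (h.p₁_left_eq_zero ha)
    (h.rotate.p₁_left_eq_zero ha) (h.rotate.rotate.p₁_left_eq_zero ha)

lemma z₁_left_mul_p₁_right (h : IsotropicPair A B x₁ x₂ x₃ z₁ z₂ z₃ p₁ p₂ p₃)
    {a b : W} (ha : a ∈ A) (hb : b ∈ B) : z₁ a * p₁ b = 0 := by
  simpa [h.p₁_left_eq_zero ha, h.rotate.x₁_left_eq_zero ha,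
    h.rotate.rotate.x₁_left_eq_zero ha] using h.coeff_x₁ a ha b hb

lemma p₂_right_eq_zero_of_ne (h : IsotropicPair A B x₁ x₂ x₃ z₁ z₂ z₃ p₁ p₂ p₃)
    {b : W} (hb : b ∈ B) (h₁ : p₁ b ≠ 0) : p₂ b = 0 := by
  by_contra h₂
  obtain ⟨a, ha, e₃, hne⟩ := h.exists_left_ne_zero z₃
  exact hne (h.left_eq_zero ha
    ((mul_eq_zero.1 (h.z₁_left_mul_p₁_right ha hb)).resolve_right h₁)
    ((mul_eq_zero.1 (h.rotate.z₁_left_mul_p₁_right ha hb)).resolve_right h₂) e₃)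

lemma p₁_right_eq_zero (h : IsotropicPair A B x₁ x₂ x₃ z₁ z₂ z₃ p₁ p₂ p₃)
    {b : W} (hb : b ∈ B) : p₁ b = 0 := by
  by_contra h₁
  have h₂ := h.p₂_right_eq_zero_of_ne hb h₁
  have h₃ : p₃ b ≠ 0 := fun e => h₁ (by linear_combination h.sum_eq b - h₂ - e)
  exact h₁ (h.rotate.rotate.p₂_right_eq_zero_of_ne hb h₃)

lemma z₁_left_mul_x₁_right (h : IsotropicPair A B x₁ x₂ x₃ z₁ z₂ z₃ p₁ p₂ p₃)
    {a b : W} (ha : a ∈ A) (hb : b ∈ B) : z₁ a * x₁ b = z₂ a * x₂ b := by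
  simpa [h.x₁_left_eq_zero ha, h.rotate.x₁_left_eq_zero ha] using h.coeff_p₁₂ a ha b hb

lemma x₂_right_eq_zero_of_ne (h : IsotropicPair A B x₁ x₂ x₃ z₁ z₂ z₃ p₁ p₂ p₃)
    {b : W} (hb : b ∈ B) (h₁ : x₁ b ≠ 0) : x₂ b = 0 := by
  by_contra h₂
  obtain ⟨a, ha, e₃, hne⟩ := h.exists_left_ne_zero z₃
  have e₂ : z₂ a = 0 := by simpa [e₃, h₂] using h.rotate.z₁_left_mul_x₁_right ha hb
  have e₁ : z₁ a = 0 := by simpa [e₂, h₁] using h.z₁_left_mul_x₁_right ha hb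
  exact hne (h.left_eq_zero ha e₁ e₂ e₃)

lemma x₂_right_eq_zero (h : IsotropicPair A B x₁ x₂ x₃ z₁ z₂ z₃ p₁ p₂ p₃)
    {b c : W} (hb : b ∈ B) (h₁ : x₁ b ≠ 0) (hc : c ∈ B) : x₂ c = 0 := by
  by_contra h₂
  have hc₁ : x₁ c = 0 := by
    by_contra e
    exact h₂ (h.x₂_right_eq_zero_of_ne hc e)
  have := h.x₂_right_eq_zero_of_ne (B.add_mem hb hc) (by simpa [hc₁] using h₁)
  rw [map_add, h.x₂_right_eq_zero_of_ne hb h₁, zero_add] at this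
  exact h₂ this

lemma x₃_right_eq_zero (h : IsotropicPair A B x₁ x₂ x₃ z₁ z₂ z₃ p₁ p₂ p₃)
    {b c : W} (hb : b ∈ B) (h₁ : x₁ b ≠ 0) (hc : c ∈ B) : x₃ c = 0 := by
  by_contra h₃
  exact h₁ (h.rotate.rotate.x₂_right_eq_zero hc h₃ hb)

lemma vanishing_of_ne (h : IsotropicPair A B x₁ x₂ x₃ z₁ z₂ z₃ p₁ p₂ p₃)
    {b : W} (hb : b ∈ B) (h₁ : x₁ b ≠ 0) :
    (∀ c ∈ B, x₂ c = 0 ∧ x₃ c = 0 ∧ p₂ c = 0 ∧ p₃ c = 0) ∧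
      ∀ a ∈ A, z₁ a = 0 ∧ x₁ a = 0 ∧ x₂ a = 0 ∧ x₃ a = 0 ∧ p₂ a = 0 ∧ p₃ a = 0 := by
  refine ⟨fun c hc => ⟨h.x₂_right_eq_zero hb h₁ hc, h.x₃_right_eq_zero hb h₁ hc,
    h.rotate.p₁_right_eq_zero hc, h.rotate.rotate.p₁_right_eq_zero hc⟩, fun a ha => ⟨?_,
    h.x₁_left_eq_zero ha, h.rotate.x₁_left_eq_zero ha, h.rotate.rotate.x₁_left_eq_zero ha,
    h.rotate.p₁_left_eq_zero ha, h.rotate.rotate.p₁_left_eq_zero ha⟩⟩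
  simpa [h.x₂_right_eq_zero hb h₁ hb, h₁] using h.z₁_left_mul_x₁_right ha hb

lemma exists_right_x_ne (h : IsotropicPair A B x₁ x₂ x₃ z₁ z₂ z₃ p₁ p₂ p₃) :
    ∃ b ∈ B, x₁ b ≠ 0 ∨ x₂ b ≠ 0 ∨ x₃ b ≠ 0 := by
  obtain ⟨b, hb, e₁, e₂, e₃, hne⟩ := h.exists_right_ne_zero z₁ z₂ z₃
  refine ⟨b, hb, ?_⟩
  by_contra! H
  exact hne (h.eq_zero b H.1 H.2.1 H.2.2 e₁ e₂ e₃ (h.p₁_right_eq_zero hb)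
    (h.rotate.p₁_right_eq_zero hb) (h.rotate.rotate.p₁_right_eq_zero hb))

end IsotropicPair

end LinearSystem

section Contraction

open CliffordAlgebra

lemma contractLeft_contractLeft_ι_mul_ι_mul_ι (α β : Module.Dual ℂ V8) (s t u : V8) :
    contractLeft β (contractLeft α (ι ℂ s * ι ℂ t * ι ℂ u)) =
      ι ℂ ((α s * β t - α t * β s) • u - (α s * β u - α u * β s) • t +
        (α t * β u - α u * β t) • s) := by
  simp only [mul_assoc, contractLeft_ι_mul, contractLeft_ι, map_sub, map_smul, mul_sub,
    Algebra.algebraMap_eq_smul_one, mul_smul_comm, mul_one, map_add, smul_sub]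
  module

lemma contractLeft_contractLeft_eq_zero {U₄ U₆ : Submodule ℂ V8} (hU : U₄ ≤ U₆)
    {y : ExteriorAlgebra ℂ V8} (hy : y ∈ wSpan U₄ U₄ ⊤ ⊔ wSpan U₆ U₆ U₆)
    {α β : Module.Dual ℂ V8} (hα : α ∈ U₆.dualAnnihilator) (hβ : β ∈ U₄.dualAnnihilator) :
    contractLeft β (contractLeft α y) = 0 := by
  rw [Submodule.mem_dualAnnihilator] at hα hβ
  suffices h : wSpan U₄ U₄ ⊤ ⊔ wSpan U₆ U₆ U₆ ≤
      LinearMap.ker (contractLeft (Q := (0 : QuadraticForm ℂ V8)) β ∘ₗ contractLeft α) from h hy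
  refine sup_le (Submodule.span_le.2 ?_) (Submodule.span_le.2 ?_)
  · rintro _ ⟨s, hs, t, ht, u, -, rfl⟩
    rw [SetLike.mem_coe, LinearMap.mem_ker, LinearMap.comp_apply,
      contractLeft_contractLeft_ι_mul_ι_mul_ι]
    simp [hα s (hU hs), hα t (hU ht), hβ s hs, hβ t ht]
  · rintro _ ⟨s, hs, t, ht, u, hu, rfl⟩
    rw [SetLike.mem_coe, LinearMap.mem_ker, LinearMap.comp_apply,
      contractLeft_contractLeft_ι_mul_ι_mul_ι]
    simp [hα s hs, hα t ht, hα u hu]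

lemma contractLeft_contractLeft_y4 (α β : Module.Dual ℂ V8) :
    contractLeft β (contractLeft α y4) = ι ℂ (![
      α (v 3) * β (v 6) - α (v 6) * β (v 3),
      α (v 4) * β (v 6) - α (v 6) * β (v 4) + (α (v 5) * β (v 7) - α (v 7) * β (v 5)),
      α (v 4) * β (v 7) - α (v 7) * β (v 4) + (α (v 5) * β (v 6) - α (v 6) * β (v 5)),
      α (v 4) * β (v 5) - α (v 5) * β (v 4) - (α (v 0) * β (v 6) - α (v 6) * β (v 0)),
      -(α (v 3) * β (v 5) - α (v 5) * β (v 3)) - (α (v 1) * β (v 6) - α (v 6) * β (v 1)) -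
        (α (v 2) * β (v 7) - α (v 7) * β (v 2)),
      α (v 3) * β (v 4) - α (v 4) * β (v 3) - (α (v 1) * β (v 7) - α (v 7) * β (v 1)) -
        (α (v 2) * β (v 6) - α (v 6) * β (v 2)),
      α (v 0) * β (v 3) - α (v 3) * β (v 0) + (α (v 1) * β (v 4) - α (v 4) * β (v 1)) +
        (α (v 2) * β (v 5) - α (v 5) * β (v 2)),
      α (v 1) * β (v 5) - α (v 5) * β (v 1) + (α (v 2) * β (v 4) - α (v 4) * β (v 2))]) := by
  simp only [y4, map_add, contractLeft_contractLeft_ι_mul_ι_mul_ι]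
  simp only [← map_add]
  congr 1
  ext i
  fin_cases i <;> simp [v] <;> ring

end Contraction

lemma isotropicPair_of_mem_pairsY4 {P : Submodule ℂ V8 × Submodule ℂ V8}
    (hP : P ∈ pairsY4 y4) :
    IsotropicPair P.2.dualAnnihilator P.1.dualAnnihilator
      (Module.Dual.eval ℂ V8 (v 3)) (Module.Dual.eval ℂ V8 (v 4 + v 5))
      (Module.Dual.eval ℂ V8 ((1 / 2 : ℂ) • (v 5 - v 4)))
      (Module.Dual.eval ℂ V8 ((-1 / 2 : ℂ) • v 0))
      (Module.Dual.eval ℂ V8 ((1 / 2 : ℂ) • (v 1 + v 2)))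
      (Module.Dual.eval ℂ V8 (v 2 - v 1))
      (Module.Dual.eval ℂ V8 ((-2 : ℂ) • v 6)) (Module.Dual.eval ℂ V8 (v 6 + v 7))
      (Module.Dual.eval ℂ V8 (v 6 - v 7)) := by
  obtain ⟨h₄, h₆, hle, hy⟩ := hP
  have key : ∀ α ∈ P.2.dualAnnihilator, ∀ β ∈ P.1.dualAnnihilator, _ := fun α hα β hβ =>
    (ExteriorAlgebra.ι_eq_zero_iff _).1 <|
      (contractLeft_contractLeft_y4 α β).symm.trans
        (contractLeft_contractLeft_eq_zero hle hy hα hβ)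
  have d₄ := Subspace.finrank_add_finrank_dualAnnihilator_eq P.1
  have d₆ := Subspace.finrank_add_finrank_dualAnnihilator_eq P.2
  simp only [Module.finrank_fintype_fun_eq_card, Fintype.card_fin] at d₄ d₆
  refine ⟨by lia, by lia, Submodule.dualAnnihilator_anti hle, ?_, ?_, ?_, ?_, ?_, ?_, ?_, ?_,
    ?_, ?_⟩
  · intro α
    simp only [Module.Dual.eval_apply]
    simp only [map_add, map_sub, map_smul, smul_eq_mul]
    intro a₁ a₂ a₃ b₁ b₂ b₃ c₁ c₂ c₃
    have key : ∀ i, α (v i) = 0 := by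
      intro i
      fin_cases i <;> simp only [Fin.reduceFinMk, Fin.zero_eta, Fin.mk_one]
      · linear_combination -2 * b₁
      · linear_combination b₂ - 1 / 2 * b₃
      · linear_combination b₂ + 1 / 2 * b₃
      · exact a₁
      · linear_combination 1 / 2 * a₂ - a₃
      · linear_combination 1 / 2 * a₂ + a₃
      · linear_combination -1 / 2 * c₁
      · linear_combination c₂ + 1 / 2 * c₁
    refine (Pi.basisFun ℂ (Fin 8)).ext fun i => ?_
    simpa [v] using key i
  · intro α
    simp only [Module.Dual.eval_apply]
    simp only [map_add, map_sub, map_smul, smul_eq_mul]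
    ring
  all_goals
    intro α hα β hβ
    have e := key α hα β hβ
    have e₀ := congrFun e 0
    have e₁ := congrFun e 1
    have e₂ := congrFun e 2
    have e₃ := congrFun e 3
    have e₄ := congrFun e 4
    have e₅ := congrFun e 5
    have e₆ := congrFun e 6
    have e₇ := congrFun e 7
    simp at e₀ e₁ e₂ e₃ e₄ e₅ e₆ e₇
    simp only [Module.Dual.eval_apply]
    simp only [map_add, map_sub, map_smul, smul_eq_mul]
  · linear_combination e₃
  · linear_combination 1 / 2 * e₄ + 1 / 2 * e₅
  · linear_combination e₅ - e₄
  · linear_combination -2 * e₀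
  · linear_combination e₁ + e₂
  · linear_combination 1 / 2 * e₂ - 1 / 2 * e₁
  · linear_combination -1 / 2 * e₆ - 1 / 2 * e₇
  · linear_combination e₇

section Spans

lemma finrank_span_eq_of_range_eq {n : ℕ} {S : Set V8} (f : Fin n → V8) (c : Fin n → Fin 8)
    (hS : Set.range f = S) (h : ∀ i j, f j (c i) = if i = j then 1 else 0) :
    Module.finrank ℂ (Submodule.span ℂ S) = n := by
  subst hS
  have hf : LinearIndependent ℂ f := by
    rw [Fintype.linearIndependent_iff]
    intro g hg i
    simpa [h] using congrFun hg (c i)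
  simpa using finrank_span_eq_card hf

lemma finrank_span_four :
    Module.finrank ℂ (Submodule.span ℂ {v 4, v 5, v 6, v 7}) = 4 := by
  refine finrank_span_eq_of_range_eq ![v 4, v 5, v 6, v 7] ![4, 5, 6, 7] ?_ ?_
  · simp only [Matrix.range_cons, Matrix.range_empty, Set.union_empty, Set.singleton_union]
  · intro i j
    fin_cases i <;> fin_cases j <;> simp [v]

lemma finrank_span_four_sub :
    Module.finrank ℂ (Submodule.span ℂ {v 3, v 4 - v 5, v 6, v 7}) = 4 := by
  refine finrank_span_eq_of_range_eq ![v 3, v 4 - v 5, v 6, v 7] ![3, 4, 6, 7] ?_ ?_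
  · simp only [Matrix.range_cons, Matrix.range_empty, Set.union_empty, Set.singleton_union]
  · intro i j
    fin_cases i <;> fin_cases j <;> simp [v]

lemma finrank_span_four_add :
    Module.finrank ℂ (Submodule.span ℂ {v 3, v 4 + v 5, v 6, v 7}) = 4 := by
  refine finrank_span_eq_of_range_eq ![v 3, v 4 + v 5, v 6, v 7] ![3, 4, 6, 7] ?_ ?_
  · simp only [Matrix.range_cons, Matrix.range_empty, Set.union_empty, Set.singleton_union]
  · intro i j
    fin_cases i <;> fin_cases j <;> simp [v]

lemma finrank_span_six :
    Module.finrank ℂ (Submodule.span ℂ {v 0, v 3, v 4, v 5, v 6, v 7}) = 6 := by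
  refine finrank_span_eq_of_range_eq ![v 0, v 3, v 4, v 5, v 6, v 7] ![0, 3, 4, 5, 6, 7] ?_ ?_
  · simp only [Matrix.range_cons, Matrix.range_empty, Set.union_empty, Set.singleton_union]
  · intro i j
    fin_cases i <;> fin_cases j <;> simp [v]

lemma finrank_span_six_add :
    Module.finrank ℂ (Submodule.span ℂ {v 1 + v 2, v 3, v 4, v 5, v 6, v 7}) = 6 := by
  refine finrank_span_eq_of_range_eq ![v 1 + v 2, v 3, v 4, v 5, v 6, v 7] ![1, 3, 4, 5, 6, 7] ?_ ?_
  · simp only [Matrix.range_cons, Matrix.range_empty, Set.union_empty, Set.singleton_union]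
  · intro i j
    fin_cases i <;> fin_cases j <;> simp [v]

lemma finrank_span_six_sub :
    Module.finrank ℂ (Submodule.span ℂ {v 1 - v 2, v 3, v 4, v 5, v 6, v 7}) = 6 := by
  refine finrank_span_eq_of_range_eq ![v 1 - v 2, v 3, v 4, v 5, v 6, v 7] ![1, 3, 4, 5, 6, 7] ?_ ?_
  · simp only [Matrix.range_cons, Matrix.range_empty, Set.union_empty, Set.singleton_union]
  · intro i j
    fin_cases i <;> fin_cases j <;> simp [v]

end Spans

lemma ι_mul_ι_mul_ι_rotate (s t u : V8) : ι ℂ s * ι ℂ t * ι ℂ u = ι ℂ t * ι ℂ u * ι ℂ s := by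
  rw [mul_assoc, mul_assoc, eq_neg_of_add_eq_zero_left (ι_add_mul_swap u s), mul_neg,
    ← mul_assoc, ← mul_assoc, eq_neg_of_add_eq_zero_left (ι_add_mul_swap t s), neg_mul, neg_neg]

lemma ι_mul_ι_mul_ι_mem_wSpan {S T U : Submodule ℂ V8} {s t u : V8} (hs : s ∈ S) (ht : t ∈ T)
    (hu : u ∈ U) : ι ℂ s * ι ℂ t * ι ℂ u ∈ wSpan S T U :=
  Submodule.subset_span ⟨s, hs, t, ht, u, hu, rfl⟩

lemma mem_pairsY4_of_le {U₄ U₆ : Submodule ℂ V8} (h₄ : Module.finrank ℂ U₄ = 4)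
    (h₆ : Module.finrank ℂ U₆ = 6) {P : Submodule ℂ V8 × Submodule ℂ V8} {y}
    (hP : P ∈ pairsY4 y) (hle₄ : U₄ ≤ P.1) (hle₆ : U₆ ≤ P.2) : P = (U₄, U₆) := by
  obtain ⟨d₄, d₆, -⟩ := hP
  exact Prod.ext (Submodule.eq_of_le_of_finrank_eq hle₄ (h₄.trans d₄.symm)).symm
    (Submodule.eq_of_le_of_finrank_eq hle₆ (h₆.trans d₆.symm)).symm

lemma span_pair_mem_pairsY4 :
    (Submodule.span ℂ {v 4, v 5, v 6, v 7},
      Submodule.span ℂ {v 0, v 3, v 4, v 5, v 6, v 7}) ∈ pairsY4 y4 := by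
  refine ⟨finrank_span_four, finrank_span_six, Submodule.span_mono (by grind), ?_⟩
  rw [y4, ι_mul_ι_mul_ι_rotate (v 3), ι_mul_ι_mul_ι_rotate (v 1), ι_mul_ι_mul_ι_rotate (v 1),
    ι_mul_ι_mul_ι_rotate (v 2), ι_mul_ι_mul_ι_rotate (v 2)]
  refine add_mem (add_mem (add_mem (add_mem (add_mem (Submodule.mem_sup_left ?_)
    (Submodule.mem_sup_right ?_)) (Submodule.mem_sup_left ?_)) (Submodule.mem_sup_left ?_))
    (Submodule.mem_sup_left ?_)) (Submodule.mem_sup_left ?_)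
  all_goals
    apply ι_mul_ι_mul_ι_mem_wSpan
    all_goals first
      | exact Submodule.mem_top
      | exact Submodule.subset_span (by simp)

/-- A decomposition of `y₄` for each sign `ε = ±1`: every summand except the third one has two
factors in the span of `v₄, v₅ - ε v₆, v₇, v₈`. -/
lemma y4_eq_of_mul_self_eq_one {ε : ℂ} (hε : ε * ε = 1) :
    y4 = ε • (ι ℂ (v 3) * ι ℂ (v 4 - ε • v 5) * ι ℂ (v 4)) +
      ι ℂ (v 0) * ι ℂ (v 3) * ι ℂ (v 6) +
      (1 / 2 : ℂ) • (ι ℂ (v 1 + ε • v 2) * ι ℂ (v 4 + ε • v 5) * ι ℂ (v 6 + ε • v 7)) +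
      (1 / 2 : ℂ) • (ι ℂ (v 4 - ε • v 5) * ι ℂ (v 6 - ε • v 7) * ι ℂ (v 1 - ε • v 2)) := by
  have h₁ : ι ℂ (v 3) * ι ℂ (v 4) * ι ℂ (v 4) = 0 := by rw [mul_assoc, ι_sq_zero, mul_zero]
  have h₂ : ι ℂ (v 3) * ι ℂ (v 5) * ι ℂ (v 4) = -(ι ℂ (v 3) * ι ℂ (v 4) * ι ℂ (v 5)) := by
    rw [mul_assoc, mul_assoc, eq_neg_of_add_eq_zero_left (ι_add_mul_swap (v 5) (v 4)), mul_neg]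
  rw [y4, ← ι_mul_ι_mul_ι_rotate (v 1 - ε • v 2)]
  simp only [map_add, map_sub, map_smul, mul_add, add_mul, mul_sub, sub_mul, smul_mul_assoc,
    mul_smul_comm, h₁, h₂, smul_add, smul_sub, smul_neg, smul_zero, smul_smul]
  match_scalars <;> grind

lemma mem_pairsY4_of_mul_self_eq_one {ε : ℂ} (hε : ε * ε = 1)
    (h₄ : Module.finrank ℂ (Submodule.span ℂ {v 3, v 4 - ε • v 5, v 6, v 7}) = 4)
    (h₆ : Module.finrank ℂ (Submodule.span ℂ {v 1 + ε • v 2, v 3, v 4, v 5, v 6, v 7}) = 6) :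
    (Submodule.span ℂ {v 3, v 4 - ε • v 5, v 6, v 7},
      Submodule.span ℂ {v 1 + ε • v 2, v 3, v 4, v 5, v 6, v 7}) ∈ pairsY4 y4 := by
  set U₄ := Submodule.span ℂ {v 3, v 4 - ε • v 5, v 6, v 7}
  set U₆ := Submodule.span ℂ {v 1 + ε • v 2, v 3, v 4, v 5, v 6, v 7}
  have a₃ : v 3 ∈ U₄ := Submodule.subset_span (by simp)
  have a₄ : v 4 - ε • v 5 ∈ U₄ := Submodule.subset_span (by simp)
  have a₆ : v 6 ∈ U₄ := Submodule.subset_span (by simp)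
  have a₇ : v 7 ∈ U₄ := Submodule.subset_span (by simp)
  have b₁ : v 1 + ε • v 2 ∈ U₆ := Submodule.subset_span (by simp)
  have b₃ : v 3 ∈ U₆ := Submodule.subset_span (by simp)
  have b₄ : v 4 ∈ U₆ := Submodule.subset_span (by simp)
  have b₅ : v 5 ∈ U₆ := Submodule.subset_span (by simp)
  have b₆ : v 6 ∈ U₆ := Submodule.subset_span (by simp)
  have b₇ : v 7 ∈ U₆ := Submodule.subset_span (by simp)
  refine ⟨h₄, h₆, Submodule.span_le.2 ?_, ?_⟩
  · rintro w (rfl | rfl | rfl | rfl)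
    exacts [b₃, sub_mem b₄ (U₆.smul_mem ε b₅), b₆, b₇]
  · rw [y4_eq_of_mul_self_eq_one hε, ι_mul_ι_mul_ι_rotate (v 0)]
    refine add_mem (add_mem (add_mem ?_ ?_) ?_) ?_
    · exact Submodule.smul_mem _ _ (Submodule.mem_sup_left
        (ι_mul_ι_mul_ι_mem_wSpan a₃ a₄ Submodule.mem_top))
    · exact Submodule.mem_sup_left (ι_mul_ι_mul_ι_mem_wSpan a₃ a₆ Submodule.mem_top)
    · exact Submodule.smul_mem _ _ (Submodule.mem_sup_right (ι_mul_ι_mul_ι_mem_wSpan b₁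
        (add_mem b₄ (U₆.smul_mem ε b₅)) (add_mem b₆ (U₆.smul_mem ε b₇))))
    · exact Submodule.smul_mem _ _ (Submodule.mem_sup_left (ι_mul_ι_mul_ι_mem_wSpan a₄
        (sub_mem a₆ (U₄.smul_mem ε a₇)) Submodule.mem_top))

lemma pairsY4_y4 : pairsY4 y4 =
    {(Submodule.span ℂ {v 4, v 5, v 6, v 7},
        Submodule.span ℂ {v 0, v 3, v 4, v 5, v 6, v 7}),
      (Submodule.span ℂ {v 3, v 4 - v 5, v 6, v 7},
        Submodule.span ℂ {v 1 + v 2, v 3, v 4, v 5, v 6, v 7}),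
      (Submodule.span ℂ {v 3, v 4 + v 5, v 6, v 7},
        Submodule.span ℂ {v 1 - v 2, v 3, v 4, v 5, v 6, v 7})} := by
  refine Set.Subset.antisymm (fun P hP => ?_) ?_
  · have h := isotropicPair_of_mem_pairsY4 hP
    have mem₄ (w : V8) (hw : ∀ c ∈ P.1.dualAnnihilator, c w = 0) : w ∈ P.1 :=
      (Subspace.forall_mem_dualAnnihilator_apply_eq_zero_iff P.1 w).1 hw
    have mem₆ (w : V8) (hw : ∀ c ∈ P.2.dualAnnihilator, c w = 0) : w ∈ P.2 :=
      (Subspace.forall_mem_dualAnnihilator_apply_eq_zero_iff P.2 w).1 hw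
    obtain ⟨b, hb, h₁ | h₂ | h₃⟩ := h.exists_right_x_ne
    · obtain ⟨hB, hA⟩ := h.vanishing_of_ne hb h₁
      refine Or.inl (mem_pairsY4_of_le finrank_span_four finrank_span_six hP
        (Submodule.span_le.2 ?_) (Submodule.span_le.2 ?_))
      · rintro w (rfl | rfl | rfl | rfl) <;> refine mem₄ _ fun c hc => ?_ <;>
        · have := hB c hc
          simp only [Module.Dual.eval_apply] at this
          simp only [map_add, map_sub, map_smul, smul_eq_mul] at this
          grind
      · rintro w (rfl | rfl | rfl | rfl | rfl | rfl) <;> refine mem₆ _ fun c hc => ?_ <;>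
        · have := hA c hc
          simp only [Module.Dual.eval_apply] at this
          simp only [map_add, map_sub, map_smul, smul_eq_mul] at this
          grind
    · obtain ⟨hB, hA⟩ := h.rotate.vanishing_of_ne hb h₂
      refine Or.inr (Or.inl (mem_pairsY4_of_le finrank_span_four_sub finrank_span_six_add hP
        (Submodule.span_le.2 ?_) (Submodule.span_le.2 ?_)))
      · rintro w (rfl | rfl | rfl | rfl) <;> refine mem₄ _ fun c hc => ?_ <;>
        · have := hB c hc
          simp only [Module.Dual.eval_apply] at this
          simp only [map_sub, map_smul, smul_eq_mul] at this ⊢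
          grind
      · rintro w (rfl | rfl | rfl | rfl | rfl | rfl) <;> refine mem₆ _ fun c hc => ?_ <;>
        · have := hA c hc
          simp only [Module.Dual.eval_apply] at this
          simp only [map_add, map_sub, map_smul, smul_eq_mul] at this ⊢
          grind
    · obtain ⟨hB, hA⟩ := h.rotate.rotate.vanishing_of_ne hb h₃
      refine Or.inr (Or.inr (mem_pairsY4_of_le finrank_span_four_add finrank_span_six_sub hP
        (Submodule.span_le.2 ?_) (Submodule.span_le.2 ?_)))
      · rintro w (rfl | rfl | rfl | rfl) <;> refine mem₄ _ fun c hc => ?_ <;>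
        · have := hB c hc
          simp only [Module.Dual.eval_apply] at this
          simp only [map_add, map_smul, smul_eq_mul] at this ⊢
          grind
      · rintro w (rfl | rfl | rfl | rfl | rfl | rfl) <;> refine mem₆ _ fun c hc => ?_ <;>
        · have := hA c hc
          simp only [Module.Dual.eval_apply] at this
          simp only [map_add, map_smul, smul_eq_mul] at this ⊢
          grind
  · rintro _ (rfl | rfl | rfl)
    · exact span_pair_mem_pairsY4
    · simpa only [one_smul] using mem_pairsY4_of_mul_self_eq_one (ε := 1) (by ring)
        (by rw [one_smul]; exact finrank_span_four_sub)
        (by rw [one_smul]; exact finrank_span_six_add)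
    · simpa only [neg_smul, one_smul, sub_neg_eq_add, ← sub_eq_add_neg] using
        mem_pairsY4_of_mul_self_eq_one (ε := -1) (by ring)
        (by rw [neg_smul, one_smul, sub_neg_eq_add]; exact finrank_span_four_add)
        (by rw [neg_smul, one_smul, ← sub_eq_add_neg]; exact finrank_span_six_sub)

lemma encard_pairsY4_y4 : (pairsY4 y4).encard = 3 := by
  have h₀ : ∀ w : V8, w 0 = 0 → Submodule.span ℂ {v 0, v 3, v 4, v 5, v 6, v 7} ≠
      Submodule.span ℂ {w, v 3, v 4, v 5, v 6, v 7} := by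
    intro w hw h
    have hle : Submodule.span ℂ {w, v 3, v 4, v 5, v 6, v 7} ≤
        LinearMap.ker (LinearMap.proj 0 : V8 →ₗ[ℂ] ℂ) := by
      rw [Submodule.span_le]
      rintro u (rfl | rfl | rfl | rfl | rfl | rfl) <;> simp [v, hw]
    have : v 0 ∈ Submodule.span ℂ {v 0, v 3, v 4, v 5, v 6, v 7} :=
      Submodule.subset_span (by simp)
    have := hle (h ▸ this)
    norm_num [v] at this
  have h₁ : Submodule.span ℂ {v 1 + v 2, v 3, v 4, v 5, v 6, v 7} ≠
      Submodule.span ℂ {v 1 - v 2, v 3, v 4, v 5, v 6, v 7} := by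
    intro h
    have hle : Submodule.span ℂ {v 1 - v 2, v 3, v 4, v 5, v 6, v 7} ≤
        LinearMap.ker ((LinearMap.proj 1 : V8 →ₗ[ℂ] ℂ) + LinearMap.proj 2) := by
      rw [Submodule.span_le]
      rintro u (rfl | rfl | rfl | rfl | rfl | rfl) <;> simp [v]
    have : v 1 + v 2 ∈ Submodule.span ℂ {v 1 + v 2, v 3, v 4, v 5, v 6, v 7} :=
      Submodule.subset_span (by simp)
    have : (v 1 + v 2) 1 + (v 1 + v 2) 2 = 0 := hle (h ▸ this)
    simp [v, one_add_one_eq_two] at this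
  rw [pairsY4_y4, Set.encard_eq_three]
  exact ⟨_, _, _, fun h => h₀ (v 1 + v 2) (by simp [v]) (congrArg Prod.snd h),
    fun h => h₀ (v 1 - v 2) (by simp [v]) (congrArg Prod.snd h),
    fun h => h₁ (congrArg Prod.snd h), rfl⟩

lemma map_mem_wSpan_map (g : V8 →ₗ[ℂ] V8) {S T U : Submodule ℂ V8} :
    (wSpan S T U).map (ExteriorAlgebra.map g).toLinearMap ≤
      wSpan (S.map g) (T.map g) (U.map g) := by
  rw [wSpan, Submodule.map_span, Submodule.span_le]
  rintro _ ⟨_, ⟨s, hs, t, ht, u, hu, rfl⟩, rfl⟩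
  simpa using ι_mul_ι_mul_ι_mem_wSpan (Submodule.mem_map_of_mem (f := g) hs)
    (Submodule.mem_map_of_mem (f := g) ht) (Submodule.mem_map_of_mem (f := g) hu)

lemma map_mem_pairsY4 (g : V8 ≃ₗ[ℂ] V8) {y : ExteriorAlgebra ℂ V8}
    {P : Submodule ℂ V8 × Submodule ℂ V8} (hP : P ∈ pairsY4 y) :
    Prod.map (Submodule.map (g : V8 →ₗ[ℂ] V8)) (Submodule.map (g : V8 →ₗ[ℂ] V8)) P ∈
      pairsY4 (ExteriorAlgebra.map (g : V8 →ₗ[ℂ] V8) y) := by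
  obtain ⟨h₄, h₆, hle, hy⟩ := hP
  refine ⟨(g.finrank_map_eq P.1).trans h₄, (g.finrank_map_eq P.2).trans h₆,
    Submodule.map_mono hle, ?_⟩
  have := Submodule.mem_map_of_mem (f := (ExteriorAlgebra.map (g : V8 →ₗ[ℂ] V8)).toLinearMap) hy
  rw [Submodule.map_sup] at this
  refine sup_le_sup ((map_mem_wSpan_map _).trans_eq ?_) (map_mem_wSpan_map _) this
  simp

lemma encard_pairsY4_map (g : V8 ≃ₗ[ℂ] V8) (y : ExteriorAlgebra ℂ V8) :
    (pairsY4 (ExteriorAlgebra.map (g : V8 →ₗ[ℂ] V8) y)).encard = (pairsY4 y).encard := by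
  have key (g : V8 ≃ₗ[ℂ] V8) (y : ExteriorAlgebra ℂ V8) :
      (pairsY4 y).encard ≤ (pairsY4 (ExteriorAlgebra.map (g : V8 →ₗ[ℂ] V8) y)).encard := by
    have hinj := Submodule.map_injective_of_injective (f := (g : V8 →ₗ[ℂ] V8)) g.injective
    rw [← (hinj.prodMap hinj).encard_image]
    exact Set.encard_le_encard (Set.image_subset_iff.2 fun P hP => map_mem_pairsY4 g hP)
  refine le_antisymm ((key g.symm _).trans_eq ?_) (key g y)
  rw [← AlgHom.comp_apply, ExteriorAlgebra.map_comp_map]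
  simp

theorem three_pairs_over_Y4 :
    (∀ g : V8 ≃ₗ[ℂ] V8, (pairsY4 (ExteriorAlgebra.map (g : V8 →ₗ[ℂ] V8) y4)).encard = 3) ∧
    pairsY4 y4 =
      {(Submodule.span ℂ {v 4, v 5, v 6, v 7},
          Submodule.span ℂ {v 0, v 3, v 4, v 5, v 6, v 7}),
       (Submodule.span ℂ {v 3, v 4 - v 5, v 6, v 7},
          Submodule.span ℂ {v 1 + v 2, v 3, v 4, v 5, v 6, v 7}),
       (Submodule.span ℂ {v 3, v 4 + v 5, v 6, v 7},
          Submodule.span ℂ {v 1 - v 2, v 3, v 4, v 5, v 6, v 7})} := by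
  exact ⟨fun g => (encard_pairsY4_map g y4).trans encard_pairsY4_y4, pairsY4_y4⟩
end
end

section
/- Let V₈ = ℂ⁸ with standard basis v₁,…,v₈ and let y₄ := v₄∧v₅∧v₆ + v₁∧v₄∧v₇ + v₂∧v₅∧v₇ + v₂∧v₆∧v₈ + v₃∧v₅∧v₈ + v₃∧v₆∧v₇ ∈ ⋀³V₈. For every g ∈ GL(V₈), setting y := (⋀³g)(y₄), there exists exactly one pair of subspaces (V₂, V₅) with dim V₂ = 2, dim V₅ = 5 and V₂ ⊆ V₅ ⊆ V₈ such that y ∈ ⋀³V₅ + V₂∧V₅∧V₈. Moreover, for g = id this pair is (span{v₇,v₈}, span{v₄,v₅,v₆,v₇,v₈}). -/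
open ExteriorAlgebra

noncomputable section

/-- The set of pairs `(V₂, V₅)` with `dim V₂ = 2`, `dim V₅ = 5`, `V₂ ⊆ V₅` and
`y ∈ ⋀³V₅ + V₂∧V₅∧V₈`. -/
def pairs25 (y : ExteriorAlgebra ℂ V8) : Set (Submodule ℂ V8 × Submodule ℂ V8) :=
  {P | Module.finrank ℂ P.1 = 2 ∧ Module.finrank ℂ P.2 = 5 ∧ P.1 ≤ P.2 ∧
    y ∈ wSpan P.2 P.2 P.2 ⊔ wSpan P.1 P.2 ⊤}

section

variable {K E : Type*} [Field K] [AddCommGroup E] [Module K E]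

theorem Submodule.exists_mem_ne_zero_of_card_lt_finrank (S : Submodule K E) {n : ℕ}
    (φ : Fin n → E →ₗ[K] K) (h : n < Module.finrank K S) :
    ∃ x ∈ S, x ≠ 0 ∧ ∀ i, φ i x = 0 := by
  have : FiniteDimensional K S := Module.finite_of_finrank_pos (by omega)
  have hker : LinearMap.ker ((LinearMap.pi φ).comp S.subtype) ≠ ⊥ :=
    LinearMap.ker_ne_bot_of_finrank_lt (by simpa using h)
  obtain ⟨x, hx, hx0⟩ := (Submodule.ne_bot_iff _).1 hker
  refine ⟨x, x.2, by simpa using hx0, fun i => ?_⟩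
  simpa using congrFun (LinearMap.mem_ker.1 hx) i

/-- Coordinates `u`, `m`, `l` with `l 0 + l 1 + l 2 = 0`, and subspaces `A ≤ B` of dimensions
`3` and `6`, such that the alternating form
`T = m₀ ∧ m₁ ∧ m₂ + ∑ i, uᵢ ∧ mᵢ ∧ lᵢ` satisfies `T(A, A, E) = 0` and `T(A, B, B) = 0`.
The vanishing of `T(A, A, E)` is spelled out coefficientwise. -/
structure IsotropicFlag (u m l : Fin 3 → E →ₗ[K] K) (A B : Submodule K E) : Prop where
  sum_l : ∀ x, l 0 x + l 1 x + l 2 x = 0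
  eq_zero : ∀ x, (∀ i, u i x = 0) → (∀ i, m i x = 0) → (∀ i, l i x = 0) → x = 0
  finrank_A : Module.finrank K A = 3
  finrank_B : Module.finrank K B = 6
  coeff_u : ∀ a ∈ A, ∀ a' ∈ A, ∀ i, m i a * l i a' = l i a * m i a'
  coeff_m : ∀ a ∈ A, ∀ a' ∈ A, ∀ i, m (i + 1) a * m (i + 2) a' - m (i + 2) a * m (i + 1) a'
    + l i a * u i a' - u i a * l i a' = 0
  coeff_l : ∀ a ∈ A, ∀ a' ∈ A, ∀ i,
    u i a * m i a' - m i a * u i a' = u (i + 1) a * m (i + 1) a' - m (i + 1) a * u (i + 1) a'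
  form : ∀ a ∈ A, ∀ b ∈ B, ∀ b' ∈ B,
    ∑ i, (m i a * (m (i + 1) b * m (i + 2) b' - m (i + 2) b * m (i + 1) b')
      + u i a * (m i b * l i b' - l i b * m i b')
      - m i a * (u i b * l i b' - l i b * u i b')
      + l i a * (u i b * m i b' - m i b * u i b')) = 0

namespace IsotropicFlag

variable {u m l : Fin 3 → E →ₗ[K] K} {A B : Submodule K E}

theorem rotate (h : IsotropicFlag u m l A B) :
    IsotropicFlag (fun i => u (i + 1)) (fun i => m (i + 1)) (fun i => l (i + 1)) A B where
  sum_l x := by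
    have := h.sum_l x
    simp only [Fin.isValue, zero_add, show (1 + 1 : Fin 3) = 2 from rfl,
      show (2 + 1 : Fin 3) = 0 from rfl]
    linear_combination this
  eq_zero x hu hm hl := by
    refine h.eq_zero x (fun i => ?_) (fun i => ?_) (fun i => ?_)
    · simpa using hu (i - 1)
    · simpa using hm (i - 1)
    · simpa using hl (i - 1)
  finrank_A := h.finrank_A
  finrank_B := h.finrank_B
  coeff_u a ha a' ha' i := h.coeff_u a ha a' ha' (i + 1)
  coeff_m a ha a' ha' i := by
    simpa only [add_right_comm] using h.coeff_m a ha a' ha' (i + 1)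
  coeff_l a ha a' ha' i := h.coeff_l a ha a' ha' (i + 1)
  form a ha b hb b' hb' := by
    have e := h.form a ha b hb b' hb'
    rw [← Equiv.sum_comp (Equiv.addRight (1 : Fin 3))] at e
    simpa only [Equiv.coe_addRight, add_right_comm] using e

/-- Vanishing of all coordinates, with the redundant `l 2` dropped. -/
theorem eq_zero' (h : IsotropicFlag u m l A B) {x : E} (hu0 : u 0 x = 0) (hu1 : u 1 x = 0)
    (hu2 : u 2 x = 0) (hm0 : m 0 x = 0) (hm1 : m 1 x = 0) (hm2 : m 2 x = 0)
    (hl1 : l 1 x = 0) (hl2 : l 2 x = 0) : x = 0 := by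
  have hl0 : l 0 x = 0 := by linear_combination h.sum_l x - hl1 - hl2
  exact h.eq_zero x (by intro i; fin_cases i <;> assumption)
    (by intro i; fin_cases i <;> assumption) (by intro i; fin_cases i <;> assumption)

theorem prod_l_eq_zero (h : IsotropicFlag u m l A B) {a : E} (ha : a ∈ A) :
    l 0 a = 0 ∨ l 1 a = 0 ∨ l 2 a = 0 := by
  by_contra! hl
  obtain ⟨k, hk, hk0, hφ⟩ := A.exists_mem_ne_zero_of_card_lt_finrank ![l 1, l 2]
    (by rw [h.finrank_A]; norm_num)
  have h1 : l 1 k = 0 := hφ 0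
  have h2 : l 2 k = 0 := hφ 1
  have hlk : ∀ i, l i k = 0 := by
    intro i
    fin_cases i
    · change l 0 k = 0
      linear_combination h.sum_l k - h1 - h2
    · exact h1
    · exact h2
  have hla : ∀ i, l i a ≠ 0 := by
    intro i
    fin_cases i
    exacts [hl.1, hl.2.1, hl.2.2]
  have hmk : ∀ i, m i k = 0 := fun i => by
    have := h.coeff_u a ha k hk i
    simpa [hlk, hla] using this
  refine hk0 (h.eq_zero k (fun i => ?_) hmk hlk)
  have := h.coeff_m a ha k hk i
  simpa [hlk, hla, hmk] using this

theorem l_zero_ne_zero [Infinite K] (h : IsotropicFlag u m l A B) {a : E} (ha : a ∈ A)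
    (hl1 : l 1 a ≠ 0) : l 0 a ≠ 0 := by
  intro hl0
  have hl2 : l 2 a ≠ 0 := fun h2 => hl1 (by linear_combination h.sum_l a - hl0 - h2)
  have hA0 : ∀ x ∈ A, l 0 x = 0 := by
    intro x hx
    classical
    obtain ⟨c, hc⟩ := Infinite.exists_notMem_finset {-(l 1 x / l 1 a), -(l 2 x / l 2 a)}
    simp only [Finset.mem_insert, Finset.mem_singleton, not_or] at hc
    rcases h.prod_l_eq_zero (A.add_mem hx (A.smul_mem c ha)) with h0 | h1 | h2
    · simpa [hl0] using h0
    · refine absurd ?_ hc.1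
      simp only [map_add, map_smul, smul_eq_mul] at h1
      field_simp
      linear_combination h1
    · refine absurd ?_ hc.2
      simp only [map_add, map_smul, smul_eq_mul] at h2
      field_simp
      linear_combination h2
  have key : ∀ k ∈ A, l 1 k = 0 → u 0 k = 0 → m 0 k = 0 → k = 0 := by
    intro k hk h1 hu hm
    have h0 := hA0 k hk
    have h2 : l 2 k = 0 := by linear_combination h.sum_l k - h0 - h1
    have hm1 : m 1 k = 0 := by simpa [h1, hl1] using h.coeff_u a ha k hk 1
    have hm2 : m 2 k = 0 := by simpa [h2, hl2] using h.coeff_u a ha k hk 2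
    have e1 := h.coeff_m a ha k hk 1
    have e2 := h.coeff_m a ha k hk 2
    simp only [Fin.isValue, show (1 + 1 : Fin 3) = 2 from rfl, show (1 + 2 : Fin 3) = 0 from rfl,
      show (2 + 1 : Fin 3) = 0 from rfl, show (2 + 2 : Fin 3) = 1 from rfl] at e1 e2
    refine h.eq_zero' hu ?_ ?_ hm hm1 hm2 h1 h2
    · simpa [h1, hm, hm2, hl1] using e1
    · simpa [h2, hm, hm1, hl2] using e2
  obtain ⟨k, hk, hk0, hφ⟩ := A.exists_mem_ne_zero_of_card_lt_finrank ![l 1, m 0]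
    (by rw [h.finrank_A]; norm_num)
  obtain ⟨k', hk', hk0', hφ'⟩ := A.exists_mem_ne_zero_of_card_lt_finrank ![l 1, u 0]
    (by rw [h.finrank_A]; norm_num)
  have p1 : l 1 k = 0 := hφ 0
  have p2 : m 0 k = 0 := hφ 1
  have q1 : l 1 k' = 0 := hφ' 0
  have q2 : u 0 k' = 0 := hφ' 1
  have hm1 : m 1 k = 0 := by simpa [p1, hl1] using h.coeff_u a ha k hk 1
  have hm1' : m 1 k' = 0 := by simpa [q1, hl1] using h.coeff_u a ha k' hk' 1
  have e := h.coeff_l k hk k' hk' 0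
  simp only [Fin.isValue, zero_add, p2, q2, hm1, hm1', mul_zero, zero_mul, sub_zero,
    mul_eq_zero] at e
  rcases e with e | e
  · exact hk0 (key k hk p1 e p2)
  · exact hk0' (key k' hk' q1 q2 e)

theorem l_eq_zero [Infinite K] (h : IsotropicFlag u m l A B) {a : E} (ha : a ∈ A) (i : Fin 3) :
    l i a = 0 := by
  have r1 : l 1 a ≠ 0 → l 0 a ≠ 0 := h.l_zero_ne_zero ha
  have r2 : l 2 a ≠ 0 → l 1 a ≠ 0 := h.rotate.l_zero_ne_zero ha
  have r3 : l 0 a ≠ 0 → l 2 a ≠ 0 := h.rotate.rotate.l_zero_ne_zero ha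
  have hp := h.prod_l_eq_zero ha
  fin_cases i <;> change l _ a = 0 <;> tauto

theorem m_mul_eq [Infinite K] (h : IsotropicFlag u m l A B) {a a' : E} (ha : a ∈ A)
    (ha' : a' ∈ A) (i : Fin 3) : m (i + 1) a * m (i + 2) a' = m (i + 2) a * m (i + 1) a' := by
  have := h.coeff_m a ha a' ha' i
  rw [h.l_eq_zero ha, h.l_eq_zero ha'] at this
  linear_combination this

/-- No vector of `A` has `m 0` and `m 1` both nonzero. -/
theorem m_zero_or_m_one [Infinite K] (h : IsotropicFlag u m l A B) {a : E} (ha : a ∈ A)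
    (h0 : m 0 a ≠ 0) : m 1 a = 0 := by
  by_contra h1
  obtain ⟨k, hk, hk0, hφ⟩ := A.exists_mem_ne_zero_of_card_lt_finrank ![m 0, u 2]
    (by rw [h.finrank_A]; norm_num)
  have p0 : m 0 k = 0 := hφ 0
  have pu : u 2 k = 0 := hφ 1
  have p1 : m 1 k = 0 := by simpa [p0, h0] using h.m_mul_eq ha hk 2
  have p2 : m 2 k = 0 := by simpa [p0, h0] using (h.m_mul_eq ha hk 1).symm
  have e0 := h.coeff_l k hk a ha 1
  have e1 := h.coeff_l k hk a ha 2
  simp only [Fin.isValue, show (1 + 1 : Fin 3) = 2 from rfl,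
    show (2 + 1 : Fin 3) = 0 from rfl] at e0 e1
  exact hk0 (h.eq_zero' (by simpa [p0, p1, p2, pu, h0] using e1.symm)
    (by simpa [p0, p1, p2, pu, h1] using e0) pu p0 p1 p2 (h.l_eq_zero hk 1) (h.l_eq_zero hk 2))

theorem m_zero_eq_zero [Infinite K] (h : IsotropicFlag u m l A B) {a : E} (ha : a ∈ A) :
    m 0 a = 0 := by
  by_contra h0
  have h1 : m 1 a = 0 := h.m_zero_or_m_one ha h0
  have h2 : m 2 a = 0 := by
    by_contra h2
    exact h0 (h.rotate.rotate.m_zero_or_m_one ha h2)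
  have hl := fun i => h.l_eq_zero ha i
  have hK : ∀ k ∈ A, m 0 k = 0 → (∀ i, m i k = 0) ∧ u 0 k = 0 := by
    intro k hk p0
    have p1 : m 1 k = 0 := by simpa [p0, h0] using h.m_mul_eq ha hk 2
    have p2 : m 2 k = 0 := by simpa [p0, h0] using (h.m_mul_eq ha hk 1).symm
    refine ⟨by intro i; fin_cases i <;> assumption, ?_⟩
    simpa [p0, p1, h0, h1] using h.coeff_l k hk a ha 0
  -- the forms `mᵢ ∧ lᵢ` for `i = 1, 2` vanish on `B`
  have w1 : ∀ b ∈ B, ∀ b' ∈ B, m 1 b * l 1 b' = l 1 b * m 1 b' := by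
    intro b hb b' hb'
    obtain ⟨k, hk, hk0, hφ⟩ := A.exists_mem_ne_zero_of_card_lt_finrank ![m 0, u 2]
      (by rw [h.finrank_A]; norm_num)
    have pu : u 2 k = 0 := hφ 1
    obtain ⟨pm, pu0⟩ := hK k hk (hφ 0)
    have pu1 : u 1 k ≠ 0 := fun pu1 => hk0 (h.eq_zero' pu0 pu1 pu (pm 0) (pm 1) (pm 2)
      (h.l_eq_zero hk 1) (h.l_eq_zero hk 2))
    have e := h.form k hk b hb b' hb'
    simpa [Fin.sum_univ_three, pm, h.l_eq_zero hk, pu, pu0, pu1, sub_eq_zero] using e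
  have w2 : ∀ b ∈ B, ∀ b' ∈ B, m 2 b * l 2 b' = l 2 b * m 2 b' := by
    intro b hb b' hb'
    obtain ⟨k, hk, hk0, hφ⟩ := A.exists_mem_ne_zero_of_card_lt_finrank ![m 0, u 1]
      (by rw [h.finrank_A]; norm_num)
    have pu : u 1 k = 0 := hφ 1
    obtain ⟨pm, pu0⟩ := hK k hk (hφ 0)
    have pu2 : u 2 k ≠ 0 := fun pu2 => hk0 (h.eq_zero' pu0 pu pu2 (pm 0) (pm 1) (pm 2)
      (h.l_eq_zero hk 1) (h.l_eq_zero hk 2))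
    have e := h.form k hk b hb b' hb'
    simpa [Fin.sum_univ_three, pm, h.l_eq_zero hk, pu, pu0, pu2, sub_eq_zero] using e
  have w : ∀ b ∈ B, ∀ b' ∈ B, m 0 a * (m 1 b * m 2 b' - m 2 b * m 1 b')
      + u 0 a * (m 0 b * l 0 b' - l 0 b * m 0 b') - m 0 a * (u 0 b * l 0 b' - l 0 b * u 0 b')
      = 0 := by
    intro b hb b' hb'
    have e := h.form a ha b hb b' hb'
    simp only [Fin.sum_univ_three, h1, h2, hl, Fin.isValue, zero_add] at e
    linear_combination e - u 1 a * w1 b hb b' hb' - u 2 a * w2 b hb b' hb'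
  have hB : ∀ φ : Fin 5 → E →ₗ[K] K, ∃ x ∈ B, x ≠ 0 ∧ ∀ i, φ i x = 0 := fun φ =>
    B.exists_mem_ne_zero_of_card_lt_finrank φ (by rw [h.finrank_B]; norm_num)
  by_cases c1 : ∀ b ∈ B, l 1 b = 0 <;> by_cases c2 : ∀ b ∈ B, l 2 b = 0
  · have c0 : ∀ b ∈ B, l 0 b = 0 := fun b hb => by
      linear_combination h.sum_l b - c1 b hb - c2 b hb
    obtain ⟨k, hk, hk0, hφ⟩ := hB ![u 0, u 1, u 2, m 0, m 1]
    obtain ⟨k', hk', hk0', hφ'⟩ := hB ![u 0, u 1, u 2, m 0, m 2]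
    have pm1 : m 1 k = 0 := hφ 4
    have pm2 : m 2 k ≠ 0 := fun e => hk0 (h.eq_zero' (hφ 0) (hφ 1) (hφ 2) (hφ 3) (hφ 4) e
      (c1 k hk) (c2 k hk))
    have qm1 : m 1 k' ≠ 0 := fun e => hk0' (h.eq_zero' (hφ' 0) (hφ' 1) (hφ' 2) (hφ' 3) e (hφ' 4)
      (c1 k' hk') (c2 k' hk'))
    have := w k hk k' hk'
    simp [pm1, pm2, qm1, h0, c0 k hk, c0 k' hk'] at this
  · push Not at c2
    obtain ⟨b, hb, hb2⟩ := c2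
    have hb0 : l 0 b ≠ 0 := fun e => hb2 (by linear_combination h.sum_l b - e - c1 b hb)
    obtain ⟨k, hk, hk0, hφ⟩ := hB ![u 1, u 2, m 0, m 1, l 2]
    have pm0 : m 0 k = 0 := hφ 2
    have pm1 : m 1 k = 0 := hφ 3
    have pl2 : l 2 k = 0 := hφ 4
    have pm2 : m 2 k = 0 := by simpa [pl2, hb2] using w2 k hk b hb
    have pl1 := c1 k hk
    have pl0 : l 0 k = 0 := by linear_combination h.sum_l k - pl1 - pl2
    have pu0 : u 0 k = 0 := by simpa [pm0, pm1, pm2, pl0, hb0, h0] using w k hk b hb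
    exact hk0 (h.eq_zero' pu0 (hφ 0) (hφ 1) pm0 pm1 pm2 pl1 pl2)
  · push Not at c1
    obtain ⟨b, hb, hb1⟩ := c1
    have hb0 : l 0 b ≠ 0 := fun e => hb1 (by linear_combination h.sum_l b - e - c2 b hb)
    obtain ⟨k, hk, hk0, hφ⟩ := hB ![u 1, u 2, m 0, m 2, l 1]
    have pm0 : m 0 k = 0 := hφ 2
    have pm2 : m 2 k = 0 := hφ 3
    have pl1 : l 1 k = 0 := hφ 4
    have pm1 : m 1 k = 0 := by simpa [pl1, hb1] using w1 k hk b hb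
    have pl2 := c2 k hk
    have pl0 : l 0 k = 0 := by linear_combination h.sum_l k - pl1 - pl2
    have pu0 : u 0 k = 0 := by simpa [pm0, pm1, pm2, pl0, hb0, h0] using w k hk b hb
    exact hk0 (h.eq_zero' pu0 (hφ 0) (hφ 1) pm0 pm1 pm2 pl1 pl2)
  · push Not at c1 c2
    obtain ⟨b, hb, hb1⟩ := c1
    obtain ⟨b', hb', hb2⟩ := c2
    by_cases c0 : ∀ b ∈ B, l 0 b = 0
    · obtain ⟨k, hk, hk0, hφ⟩ := hB ![u 0, u 1, u 2, m 0, l 1]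
      have pl1 : l 1 k = 0 := hφ 4
      have pl2 : l 2 k = 0 := by linear_combination h.sum_l k - c0 k hk - pl1
      exact hk0 (h.eq_zero' (hφ 0) (hφ 1) (hφ 2) (hφ 3)
        (by simpa [pl1, hb1] using w1 k hk b hb) (by simpa [pl2, hb2] using w2 k hk b' hb')
        pl1 pl2)
    · push Not at c0
      obtain ⟨b₀, hb₀, hbl⟩ := c0
      obtain ⟨k, hk, hk0, hφ⟩ := hB ![u 1, u 2, m 0, l 1, l 2]
      have pm0 : m 0 k = 0 := hφ 2
      have pl1 : l 1 k = 0 := hφ 3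
      have pl2 : l 2 k = 0 := hφ 4
      have pl0 : l 0 k = 0 := by linear_combination h.sum_l k - pl1 - pl2
      have pm1 : m 1 k = 0 := by simpa [pl1, hb1] using w1 k hk b hb
      have pm2 : m 2 k = 0 := by simpa [pl2, hb2] using w2 k hk b' hb'
      have pu0 : u 0 k = 0 := by simpa [pm0, pm1, pm2, pl0, hbl, h0] using w k hk b₀ hb₀
      exact hk0 (h.eq_zero' pu0 (hφ 0) (hφ 1) pm0 pm1 pm2 pl1 pl2)

theorem m_eq_zero [Infinite K] (h : IsotropicFlag u m l A B) {a : E} (ha : a ∈ A) (i : Fin 3) :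
    m i a = 0 := by
  fin_cases i
  · exact h.m_zero_eq_zero ha
  · exact h.rotate.m_zero_eq_zero ha
  · exact h.rotate.rotate.m_zero_eq_zero ha

theorem m_mul_l_zero [Infinite K] (h : IsotropicFlag u m l A B) {b b' : E} (hb : b ∈ B)
    (hb' : b' ∈ B) : m 0 b * l 0 b' = l 0 b * m 0 b' := by
  obtain ⟨k, hk, hk0, hφ⟩ := A.exists_mem_ne_zero_of_card_lt_finrank ![u 1, u 2]
    (by rw [h.finrank_A]; norm_num)
  have pu1 : u 1 k = 0 := hφ 0
  have pu2 : u 2 k = 0 := hφ 1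
  have pm := fun i => h.m_eq_zero hk i
  have pl := fun i => h.l_eq_zero hk i
  have pu0 : u 0 k ≠ 0 := fun e => hk0 (h.eq_zero' e pu1 pu2 (pm 0) (pm 1) (pm 2) (pl 1) (pl 2))
  simpa [Fin.sum_univ_three, pm, pl, pu0, pu1, pu2, sub_eq_zero] using h.form k hk b hb b' hb'

/-- `l 1` and `l 2` do not both take nonzero values on `B`. -/
theorem l_one_or_l_two [Infinite K] (h : IsotropicFlag u m l A B) {b b' : E} (hb : b ∈ B)
    (hb' : b' ∈ B) (hb1 : l 1 b ≠ 0) : l 2 b' = 0 := by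
  by_contra hb2
  have w0 : ∀ b ∈ B, ∀ b' ∈ B, m 0 b * l 0 b' = l 0 b * m 0 b' :=
    fun b hb b' hb' => h.m_mul_l_zero hb hb'
  have w1 : ∀ b ∈ B, ∀ b' ∈ B, m 1 b * l 1 b' = l 1 b * m 1 b' :=
    fun b hb b' hb' => h.rotate.m_mul_l_zero hb hb'
  have w2 : ∀ b ∈ B, ∀ b' ∈ B, m 2 b * l 2 b' = l 2 b * m 2 b' :=
    fun b hb b' hb' => h.rotate.rotate.m_mul_l_zero hb hb'
  have hB : ∀ φ : Fin 5 → E →ₗ[K] K, ∃ x ∈ B, x ≠ 0 ∧ ∀ i, φ i x = 0 := fun φ =>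
    B.exists_mem_ne_zero_of_card_lt_finrank φ (by rw [h.finrank_B]; norm_num)
  by_cases c0 : ∀ b ∈ B, l 0 b = 0
  · obtain ⟨k, hk, hk0, hφ⟩ := hB ![u 0, u 1, u 2, m 0, l 1]
    have pl1 : l 1 k = 0 := hφ 4
    have pl2 : l 2 k = 0 := by linear_combination h.sum_l k - c0 k hk - pl1
    exact hk0 (h.eq_zero' (hφ 0) (hφ 1) (hφ 2) (hφ 3)
      (by simpa [pl1, hb1] using w1 k hk b hb) (by simpa [pl2, hb2] using w2 k hk b' hb')
      pl1 pl2)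
  · push Not at c0
    obtain ⟨b₀, hb₀, hbl⟩ := c0
    obtain ⟨k, hk, hk0, hφ⟩ := hB ![u 0, u 1, u 2, l 1, l 2]
    have pl1 : l 1 k = 0 := hφ 3
    have pl2 : l 2 k = 0 := hφ 4
    have pl0 : l 0 k = 0 := by linear_combination h.sum_l k - pl1 - pl2
    exact hk0 (h.eq_zero' (hφ 0) (hφ 1) (hφ 2)
      (by simpa [pl0, hbl] using w0 k hk b₀ hb₀) (by simpa [pl1, hb1] using w1 k hk b hb)
      (by simpa [pl2, hb2] using w2 k hk b' hb') pl1 pl2)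

theorem l_eq_zero_of_mem_B [Infinite K] (h : IsotropicFlag u m l A B) {b : E} (hb : b ∈ B)
    (i : Fin 3) : l i b = 0 := by
  have r1 : l 1 b ≠ 0 → l 2 b = 0 := h.l_one_or_l_two hb hb
  have r2 : l 2 b ≠ 0 → l 0 b = 0 := h.rotate.l_one_or_l_two hb hb
  have r3 : l 0 b ≠ 0 → l 1 b = 0 := h.rotate.rotate.l_one_or_l_two hb hb
  have hs := h.sum_l b
  fin_cases i <;> change l _ b = 0 <;> grind

end IsotropicFlag

end

open Module

/-- The functional `x ∧ y ∧ z ↦ det (f, g, k)(x, y, z)` on the exterior algebra. -/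
def detForm (f g k : Dual ℂ V8) : ExteriorAlgebra ℂ V8 →ₗ[ℂ] ℂ :=
  liftAlternating (Pi.single 3
    ((Matrix.detRowAlternating (R := ℂ) (n := Fin 3)).compLinearMap (LinearMap.pi ![f, g, k])))

theorem detForm_apply (f g k : Dual ℂ V8) (x y z : V8) :
    detForm f g k (ι ℂ x * ι ℂ y * ι ℂ z) =
      f x * (g y * k z - k y * g z) - g x * (f y * k z - k y * f z)
        + k x * (f y * g z - g y * f z) := by
  have h : ι ℂ x * ι ℂ y * ι ℂ z = ιMulti ℂ 3 ![x, y, z] := by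
    simp [ιMulti_apply, mul_assoc]
  rw [h, detForm, liftAlternating_apply_ιMulti, Pi.single_eq_same,
    AlternatingMap.compLinearMap_apply]
  change Matrix.det (Matrix.of fun i => LinearMap.pi ![f, g, k] (![x, y, z] i)) = _
  rw [Matrix.det_fin_three]
  simp
  ring

section

variable {y : ExteriorAlgebra ℂ V8} {P : Submodule ℂ V8 × Submodule ℂ V8}

theorem detForm_eq_zero_of_left (hP : P ∈ pairs25 y) {f g : Dual ℂ V8}
    (hf : f ∈ P.2.dualAnnihilator) (hg : g ∈ P.2.dualAnnihilator) (k : Dual ℂ V8) :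
    detForm f g k y = 0 := by
  obtain ⟨-, -, hle, hy⟩ := hP
  rw [Submodule.mem_dualAnnihilator] at hf hg
  suffices h : wSpan P.2 P.2 P.2 ⊔ wSpan P.1 P.2 ⊤ ≤ LinearMap.ker (detForm f g k) from h hy
  refine sup_le (Submodule.span_le.2 ?_) (Submodule.span_le.2 ?_)
  · rintro _ ⟨s, hs, t, ht, w, hw, rfl⟩
    simp [detForm_apply, hf s hs, hf t ht, hf w hw, hg s hs, hg t ht, hg w hw]
  · rintro _ ⟨s, hs, t, ht, w, -, rfl⟩
    simp [detForm_apply, hf s (hle hs), hf t ht, hg s (hle hs), hg t ht]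

theorem detForm_eq_zero_of_right (hP : P ∈ pairs25 y) {f g k : Dual ℂ V8}
    (hf : f ∈ P.2.dualAnnihilator) (hg : g ∈ P.1.dualAnnihilator)
    (hk : k ∈ P.1.dualAnnihilator) : detForm f g k y = 0 := by
  obtain ⟨-, -, hle, hy⟩ := hP
  rw [Submodule.mem_dualAnnihilator] at hf hg hk
  suffices h : wSpan P.2 P.2 P.2 ⊔ wSpan P.1 P.2 ⊤ ≤ LinearMap.ker (detForm f g k) from h hy
  refine sup_le (Submodule.span_le.2 ?_) (Submodule.span_le.2 ?_)
  · rintro _ ⟨s, hs, t, ht, w, hw, rfl⟩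
    simp [detForm_apply, hf s hs, hf t ht, hf w hw]
  · rintro _ ⟨s, hs, t, ht, w, -, rfl⟩
    simp [detForm_apply, hf s (hle hs), hg s hs, hk s hs]

end

/-- Evaluation of a functional at a vector of `ℂ⁸`. -/
abbrev evalAt (x : V8) : Dual ℂ V8 →ₗ[ℂ] ℂ := Dual.eval ℂ V8 x

theorem isotropicFlag_of_mem_pairs25 {P : Submodule ℂ V8 × Submodule ℂ V8}
    (hP : P ∈ pairs25 y4) :
    IsotropicFlag
      ![evalAt (v 0), evalAt ((1 / 2 : ℂ) • (v 1 + v 2)), evalAt ((1 / 2 : ℂ) • (v 1 - v 2))]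
      ![evalAt ((-1 / 2 : ℂ) • v 3), evalAt (v 4 + v 5), evalAt (v 4 - v 5)]
      ![evalAt ((-2 : ℂ) • v 6), evalAt (v 6 + v 7), evalAt (v 6 - v 7)]
      P.2.dualAnnihilator P.1.dualAnnihilator := by
  have hcoeff : ∀ a ∈ P.2.dualAnnihilator, ∀ a' ∈ P.2.dualAnnihilator, ∀ i : Fin 8,
      detForm a a' (LinearMap.proj i) y4 = 0 :=
    fun a ha a' ha' i => detForm_eq_zero_of_left hP ha ha' _
  have hv : ∀ i j : Fin 8, (LinearMap.proj i : Dual ℂ V8) (v j) = if i = j then 1 else 0 := by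
    intro i j
    simp [v, Pi.single_apply]
  simp only [y4, map_add, detForm_apply, hv] at hcoeff
  refine ⟨fun x => ?_, fun x hu hm hl => ?_, ?_, ?_, fun a ha a' ha' i => ?_,
    fun a ha a' ha' i => ?_, fun a ha a' ha' i => ?_, fun a ha b hb b' hb' => ?_⟩
  · simp
    ring
  · have hu1 := hu 1
    have hu2 := hu 2
    have hm1 := hm 1
    have hm2 := hm 2
    have hl1 := hl 1
    have hl2 := hl 2
    simp at hu1 hu2 hm1 hm2 hl1 hl2
    have h0 : x (v 0) = 0 := hu 0
    have h1 : x (v 1) = 0 := by linear_combination hu1 + hu2 / 2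
    have h2 : x (v 2) = 0 := by linear_combination hu1 - hu2 / 2
    have h3 : x (v 3) = 0 := by simpa using hm 0
    have h4 : x (v 4) = 0 := by linear_combination (hm1 + hm2) / 2
    have h5 : x (v 5) = 0 := by linear_combination (hm1 - hm2) / 2
    have h6 : x (v 6) = 0 := by linear_combination (hl1 + hl2) / 2
    have h7 : x (v 7) = 0 := by linear_combination (hl1 - hl2) / 2
    refine (Pi.basisFun ℂ (Fin 8)).ext fun i => ?_
    rw [Pi.basisFun_apply, LinearMap.zero_apply]
    fin_cases i <;> assumption
  · have := Subspace.finrank_add_finrank_dualAnnihilator_eq P.2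
    rw [hP.2.1, finrank_fin_fun] at this
    omega
  · have := Subspace.finrank_add_finrank_dualAnnihilator_eq P.1
    rw [hP.1, finrank_fin_fun] at this
    omega
  · have e0 := hcoeff a ha a' ha' 0
    have e1 := hcoeff a ha a' ha' 1
    have e2 := hcoeff a ha a' ha' 2
    simp at e0 e1 e2
    fin_cases i <;> simp
    · linear_combination -e0
    · linear_combination e1 + e2
    · linear_combination e1 - e2
  · have e0 := hcoeff a ha a' ha' 3
    have e1 := hcoeff a ha a' ha' 4
    have e2 := hcoeff a ha a' ha' 5
    simp at e0 e1 e2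
    fin_cases i <;> simp
    · linear_combination -2 * e0
    · linear_combination (e1 + e2) / 2
    · linear_combination (e1 - e2) / 2
  · have e0 := hcoeff a ha a' ha' 6
    have e1 := hcoeff a ha a' ha' 7
    simp at e0 e1
    fin_cases i <;> simp
    · linear_combination -(e0 + e1) / 2
    · linear_combination e1
    · linear_combination (e0 - e1) / 2
  · have e := detForm_eq_zero_of_right hP ha hb hb'
    simp only [y4, map_add, detForm_apply] at e
    simp [Fin.sum_univ_three]
    linear_combination e

theorem linearIndependent_v : LinearIndependent ℂ v := by
  have h := (Pi.basisFun ℂ (Fin 8)).linearIndependent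
  rwa [show (⇑(Pi.basisFun ℂ (Fin 8)) : Fin 8 → V8) = v from
    funext fun i => Pi.basisFun_apply ℂ (Fin 8) i] at h

theorem finrank_span_v67 : finrank ℂ (Submodule.span ℂ {v 6, v 7}) = 2 := by
  have h := finrank_span_eq_card (linearIndependent_v.comp ![6, 7] (by decide))
  have hr : Set.range (v ∘ ![6, 7]) = {v 6, v 7} := by
    ext x
    simp [Fin.exists_fin_succ, eq_comm]
  rwa [hr, Fintype.card_fin] at h

theorem finrank_span_v34567 : finrank ℂ (Submodule.span ℂ {v 3, v 4, v 5, v 6, v 7}) = 5 := by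
  have h := finrank_span_eq_card (linearIndependent_v.comp ![3, 4, 5, 6, 7] (by decide))
  have hr : Set.range (v ∘ ![3, 4, 5, 6, 7]) = {v 3, v 4, v 5, v 6, v 7} := by
    ext x
    simp [Fin.exists_fin_succ, eq_comm]
  rwa [hr, Fintype.card_fin] at h

theorem ι_mul_mul_swap (x y z : V8) : ι ℂ x * ι ℂ y * ι ℂ z = -(ι ℂ z * ι ℂ y * ι ℂ x) := by
  have hxy := eq_neg_of_add_eq_zero_left (ι_add_mul_swap (R := ℂ) x y)
  have hxz := eq_neg_of_add_eq_zero_left (ι_add_mul_swap (R := ℂ) x z)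
  have hyz := eq_neg_of_add_eq_zero_left (ι_add_mul_swap (R := ℂ) y z)
  rw [hxy, neg_mul, mul_assoc, hxz, mul_neg, ← mul_assoc, hyz, neg_mul, neg_neg]

theorem span_mem_pairs25 :
    (Submodule.span ℂ {v 6, v 7}, Submodule.span ℂ {v 3, v 4, v 5, v 6, v 7}) ∈ pairs25 y4 := by
  refine ⟨finrank_span_v67, finrank_span_v34567,
    Submodule.span_mono (by intro x; simp +contextual), ?_⟩
  have hM : ∀ x ∈ ({v 3, v 4, v 5, v 6, v 7} : Set V8),
      x ∈ Submodule.span ℂ {v 3, v 4, v 5, v 6, v 7} := fun x hx => Submodule.subset_span hx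
  have hL : ∀ x ∈ ({v 6, v 7} : Set V8), x ∈ Submodule.span ℂ {v 6, v 7} :=
    fun x hx => Submodule.subset_span hx
  have hr : ∀ x, ∀ y ∈ ({v 3, v 4, v 5, v 6, v 7} : Set V8), ∀ z ∈ ({v 6, v 7} : Set V8),
      ι ℂ x * ι ℂ y * ι ℂ z ∈ wSpan (Submodule.span ℂ {v 6, v 7})
        (Submodule.span ℂ {v 3, v 4, v 5, v 6, v 7}) ⊤ := by
    intro x y hy z hz
    rw [ι_mul_mul_swap]
    exact neg_mem (Submodule.subset_span ⟨z, hL z hz, y, hM y hy, x, trivial, rfl⟩)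
  unfold y4
  simp only [add_assoc]
  refine Submodule.add_mem_sup
    (Submodule.subset_span ⟨_, hM _ ?_, _, hM _ ?_, _, hM _ ?_, rfl⟩)
    (add_mem (hr _ _ ?_ _ ?_) (add_mem (hr _ _ ?_ _ ?_) (add_mem (hr _ _ ?_ _ ?_)
      (add_mem (hr _ _ ?_ _ ?_) (hr _ _ ?_ _ ?_))))) <;> simp

theorem pairs25_y4 : pairs25 y4 =
    {(Submodule.span ℂ {v 6, v 7}, Submodule.span ℂ {v 3, v 4, v 5, v 6, v 7})} := by
  refine Set.eq_singleton_iff_unique_mem.2 ⟨span_mem_pairs25, fun P hP => ?_⟩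
  have h := isotropicFlag_of_mem_pairs25 hP
  have hL : ∀ b ∈ P.1.dualAnnihilator, b (v 6) = 0 ∧ b (v 7) = 0 := by
    intro b hb
    have h1 := h.l_eq_zero_of_mem_B hb 1
    have h2 := h.l_eq_zero_of_mem_B hb 2
    simp at h1 h2
    exact ⟨by linear_combination (h1 + h2) / 2, by linear_combination (h1 - h2) / 2⟩
  have hM : ∀ a ∈ P.2.dualAnnihilator, a (v 3) = 0 ∧ a (v 4) = 0 ∧ a (v 5) = 0 := by
    intro a ha
    have h0 := h.m_eq_zero ha 0
    have h1 := h.m_eq_zero ha 1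
    have h2 := h.m_eq_zero ha 2
    simp at h0 h1 h2
    exact ⟨h0, by linear_combination (h1 + h2) / 2, by linear_combination (h1 - h2) / 2⟩
  have hle : P.2.dualAnnihilator ≤ P.1.dualAnnihilator :=
    Submodule.dualAnnihilator_anti hP.2.2.1
  refine Prod.ext (Eq.symm ?_) (Eq.symm ?_)
  · refine Submodule.eq_of_le_of_finrank_eq (Submodule.span_le.2 ?_)
      (finrank_span_v67.trans hP.1.symm)
    intro x hx
    refine (Subspace.forall_mem_dualAnnihilator_apply_eq_zero_iff P.1 x).1 fun b hb => ?_
    obtain ⟨h6, h7⟩ := hL b hb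
    rcases hx with rfl | rfl <;> assumption
  · refine Submodule.eq_of_le_of_finrank_eq (Submodule.span_le.2 ?_)
      (finrank_span_v34567.trans hP.2.1.symm)
    intro x hx
    refine (Subspace.forall_mem_dualAnnihilator_apply_eq_zero_iff P.2 x).1 fun a ha => ?_
    obtain ⟨h3, h4, h5⟩ := hM a ha
    obtain ⟨h6, h7⟩ := hL a (hle ha)
    rcases hx with rfl | rfl | rfl | rfl | rfl <;> assumption

theorem map_wSpan_le (g : V8 →ₗ[ℂ] V8) (S T U : Submodule ℂ V8) :
    (wSpan S T U).map (ExteriorAlgebra.map g).toLinearMap ≤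
      wSpan (S.map g) (T.map g) (U.map g) := by
  rw [Submodule.map_le_iff_le_comap]
  refine Submodule.span_le.2 ?_
  rintro _ ⟨s, hs, t, ht, u, hu, rfl⟩
  exact Submodule.subset_span ⟨g s, Submodule.mem_map_of_mem hs, g t, Submodule.mem_map_of_mem ht,
    g u, Submodule.mem_map_of_mem hu, by simp⟩

theorem map_mem_pairs25 (g : V8 ≃ₗ[ℂ] V8) {y : ExteriorAlgebra ℂ V8}
    {P : Submodule ℂ V8 × Submodule ℂ V8} (hP : P ∈ pairs25 y) :
    (P.1.map (g : V8 →ₗ[ℂ] V8), P.2.map (g : V8 →ₗ[ℂ] V8)) ∈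
      pairs25 (ExteriorAlgebra.map (g : V8 →ₗ[ℂ] V8) y) := by
  obtain ⟨h2, h5, hle, hy⟩ := hP
  refine ⟨(g.finrank_map_eq P.1).trans h2, (g.finrank_map_eq P.2).trans h5,
    Submodule.map_mono hle, ?_⟩
  have h := Submodule.mem_map_of_mem (f := (ExteriorAlgebra.map (g : V8 →ₗ[ℂ] V8)).toLinearMap) hy
  rw [Submodule.map_sup] at h
  refine sup_le_sup (map_wSpan_le _ _ _ _) ?_ h
  refine (map_wSpan_le _ _ _ _).trans (Submodule.span_mono ?_)
  rintro _ ⟨s, hs, t, ht, u, -, rfl⟩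
  exact ⟨s, hs, t, ht, u, trivial, rfl⟩

theorem pairs25_map (g : V8 ≃ₗ[ℂ] V8) (y : ExteriorAlgebra ℂ V8) :
    pairs25 (ExteriorAlgebra.map (g : V8 →ₗ[ℂ] V8) y) =
      (fun P : Submodule ℂ V8 × Submodule ℂ V8 =>
        (P.1.map (g : V8 →ₗ[ℂ] V8), P.2.map (g : V8 →ₗ[ℂ] V8))) '' pairs25 y := by
  have hmap : ∀ S : Submodule ℂ V8,
      (S.map (g.symm : V8 →ₗ[ℂ] V8)).map (g : V8 →ₗ[ℂ] V8) = S := by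
    intro S
    rw [← Submodule.map_comp, LinearEquiv.comp_symm, Submodule.map_id]
  refine Set.Subset.antisymm (fun P hP => ?_) ?_
  · refine ⟨(P.1.map (g.symm : V8 →ₗ[ℂ] V8), P.2.map (g.symm : V8 →ₗ[ℂ] V8)), ?_,
      Prod.ext (hmap _) (hmap _)⟩
    have h := map_mem_pairs25 g.symm hP
    rwa [← AlgHom.comp_apply, map_comp_map, LinearEquiv.symm_comp, map_id, AlgHom.id_apply] at h
  · rintro _ ⟨P, hP, rfl⟩
    exact map_mem_pairs25 g hP

theorem unique_pair_over_Y4 :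
    (∀ g : V8 ≃ₗ[ℂ] V8, (pairs25 (ExteriorAlgebra.map (g : V8 →ₗ[ℂ] V8) y4)).encard = 1) ∧
    pairs25 y4 =
      {(Submodule.span ℂ {v 6, v 7}, Submodule.span ℂ {v 3, v 4, v 5, v 6, v 7})} := by
  refine ⟨fun g => ?_, pairs25_y4⟩
  rw [pairs25_map, pairs25_y4, Set.image_singleton, Set.encard_singleton]
end
end

section
/- Let V₈ = ℂ⁸ with standard basis v₁,…,v₈ and let y₄ := v₄∧v₅∧v₆ + v₁∧v₄∧v₇ + v₂∧v₅∧v₇ + v₂∧v₆∧v₈ + v₃∧v₅∧v₈ + v₃∧v₆∧v₇. For every g ∈ GL(V₈), set y := (⋀³g)(y₄). If (V₂, V₅) is a pair of subspaces with dim V₂ = 2, dim V₅ = 5, V₂ ⊆ V₅, and y ∈ ⋀³V₅ + V₂∧V₅∧V₈, and (U₄, U₆) is a pair of subspaces with dim U₄ = 4, dim U₆ = 6, U₄ ⊆ U₆, and y ∈ ⋀²U₄∧V₈ + ⋀³U₆, then V₂ ⊆ U₄ ⊆ V₅ ⊆ U₆. -/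
open ExteriorAlgebra

noncomputable section

/-- A nonzero vector of `S` killed by fewer functionals than the dimension of `S`. -/
theorem exists_mem_ne_zero_of_lt_finrank {D : Type*} [AddCommGroup D] [Module ℂ D]
    [FiniteDimensional ℂ D] {n : ℕ} (S : Submodule ℂ D) (f : Fin n → Module.Dual ℂ D)
    (h : n < Module.finrank ℂ S) : ∃ x ∈ S, x ≠ 0 ∧ ∀ i, f i x = 0 := by
  have hk : LinearMap.ker ((LinearMap.pi f).comp S.subtype) ≠ ⊥ :=
    LinearMap.ker_ne_bot_of_finrank_lt (by simpa using h)
  obtain ⟨x, hx, hx0⟩ := Submodule.exists_mem_ne_zero_of_ne_bot hk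
  exact ⟨x, x.2, by simpa using hx0, fun i => congrFun (LinearMap.mem_ker.1 hx) i⟩

theorem finrank_le_of_forall_eq_zero {D : Type*} [AddCommGroup D] [Module ℂ D]
    [FiniteDimensional ℂ D] {n : ℕ} (S : Submodule ℂ D) (f : Fin n → Module.Dual ℂ D)
    (h : ∀ x ∈ S, (∀ i, f i x = 0) → x = 0) : Module.finrank ℂ S ≤ n := by
  by_contra! hn
  obtain ⟨x, hx, hx0, hf⟩ := exists_mem_ne_zero_of_lt_finrank S f hn
  exact hx0 (h x hx hf)

theorem Fin.forall_three_iff (i : Fin 3) {P : Fin 3 → Prop} :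
    (∀ j, P j) ↔ P i ∧ P (i + 1) ∧ P (i + 2) := by
  fin_cases i <;> simp [Fin.forall_fin_succ] <;> tauto

theorem Fin.three_add_one_add_one (i : Fin 3) : i + 1 + 1 = i + 2 := by decide +revert

theorem Fin.three_add_one_add_two (i : Fin 3) : i + 1 + 2 = i := by decide +revert

theorem Fin.three_add_two_add_one (i : Fin 3) : i + 2 + 1 = i := by decide +revert

theorem Fin.three_add_two_add_two (i : Fin 3) : i + 2 + 2 = i + 1 := by decide +revert

theorem Fin.three_add_one_ne (i : Fin 3) : i + 1 ≠ i := by decide +revert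

theorem Fin.three_add_two_ne (i : Fin 3) : i + 2 ≠ i := by decide +revert

theorem Fin.exists_third {i j : Fin 3} (h : i ≠ j) : ∃ k, ∀ l, l = i ∨ l = j ∨ l = k := by
  decide +revert

/-- Linear coordinates `aᵢ, bᵢ, cᵢ` on an `8`-dimensional space, subject only to
`c₀ + c₁ + c₂ = 0`. -/
structure AdaptedCoords (D : Type*) [AddCommGroup D] [Module ℂ D] where
  a : Fin 3 → Module.Dual ℂ D
  b : Fin 3 → Module.Dual ℂ D
  c : Fin 3 → Module.Dual ℂ D
  sum_c : ∀ x, c 0 x + c 1 x + c 2 x = 0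
  inj : ∀ x, (∀ i, a i x = 0) → (∀ i, b i x = 0) → (∀ i, c i x = 0) → x = 0
  surj : ∀ p q r : Fin 3 → ℂ, r 0 + r 1 + r 2 = 0 →
    ∃ x, (∀ i, a i x = p i) ∧ (∀ i, b i x = q i) ∧ (∀ i, c i x = r i)

namespace AdaptedCoords

variable {D : Type*} [AddCommGroup D] [Module ℂ D] (X : AdaptedCoords D)

/-- The alternating form `b₀ ∧ b₁ ∧ b₂ + ∑ᵢ aᵢ ∧ bᵢ ∧ cᵢ`. -/
def form (x y z : D) : ℂ :=
  !![X.b 0 x, X.b 1 x, X.b 2 x; X.b 0 y, X.b 1 y, X.b 2 y; X.b 0 z, X.b 1 z, X.b 2 z].det +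
  ∑ i, !![X.a i x, X.b i x, X.c i x; X.a i y, X.b i y, X.c i y; X.a i z, X.b i z, X.c i z].det

theorem sum_c_rotate (i : Fin 3) (x : D) : X.c i x + X.c (i + 1) x + X.c (i + 2) x = 0 := by
  have := X.sum_c x
  fin_cases i <;> simp <;> linear_combination this

theorem form_eq (i : Fin 3) (x y z : D) : X.form x y z =
    X.b i x * (X.b (i + 1) y * X.b (i + 2) z - X.b (i + 2) y * X.b (i + 1) z +
      (X.c i y * X.a i z - X.a i y * X.c i z)) +
    X.b (i + 1) x * (X.b (i + 2) y * X.b i z - X.b i y * X.b (i + 2) z +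
      (X.c (i + 1) y * X.a (i + 1) z - X.a (i + 1) y * X.c (i + 1) z)) +
    X.b (i + 2) x * (X.b i y * X.b (i + 1) z - X.b (i + 1) y * X.b i z +
      (X.c (i + 2) y * X.a (i + 2) z - X.a (i + 2) y * X.c (i + 2) z)) +
    X.a i x * (X.b i y * X.c i z - X.c i y * X.b i z) +
    X.a (i + 1) x * (X.b (i + 1) y * X.c (i + 1) z - X.c (i + 1) y * X.b (i + 1) z) +
    X.a (i + 2) x * (X.b (i + 2) y * X.c (i + 2) z - X.c (i + 2) y * X.b (i + 2) z) +
    X.c i x * (X.a i y * X.b i z - X.b i y * X.a i z) +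
    X.c (i + 1) x * (X.a (i + 1) y * X.b (i + 1) z - X.b (i + 1) y * X.a (i + 1) z) +
    X.c (i + 2) x * (X.a (i + 2) y * X.b (i + 2) z - X.b (i + 2) y * X.a (i + 2) z) := by
  fin_cases i <;> simp [form, Matrix.det_fin_three, Fin.sum_univ_three] <;> ring

/-- The coordinate form of `form x y · = 0`. -/
structure Contr (x y : D) : Prop where
  bc : ∀ i, X.b i x * X.c i y = X.c i x * X.b i y
  bb : ∀ i, X.b (i + 1) x * X.b (i + 2) y - X.b (i + 2) x * X.b (i + 1) y +
    (X.c i x * X.a i y - X.a i x * X.c i y) = 0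
  ab : ∀ i j, X.a i x * X.b i y - X.b i x * X.a i y = X.a j x * X.b j y - X.b j x * X.a j y

variable {X}

theorem contr_of_form_eq_zero {x y : D} (h : ∀ z, X.form x y z = 0) : X.Contr x y := by
  have key : ∀ p q r : Fin 3 → ℂ, r 0 + r 1 + r 2 = 0 → ∀ i : Fin 3,
      (X.b (i + 1) x * X.b (i + 2) y - X.b (i + 2) x * X.b (i + 1) y +
        (X.c i x * X.a i y - X.a i x * X.c i y)) * q i +
      (X.b (i + 2) x * X.b i y - X.b i x * X.b (i + 2) y +
        (X.c (i + 1) x * X.a (i + 1) y - X.a (i + 1) x * X.c (i + 1) y)) * q (i + 1) +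
      (X.b i x * X.b (i + 1) y - X.b (i + 1) x * X.b i y +
        (X.c (i + 2) x * X.a (i + 2) y - X.a (i + 2) x * X.c (i + 2) y)) * q (i + 2) +
      (X.b i x * X.c i y - X.c i x * X.b i y) * p i +
      (X.b (i + 1) x * X.c (i + 1) y - X.c (i + 1) x * X.b (i + 1) y) * p (i + 1) +
      (X.b (i + 2) x * X.c (i + 2) y - X.c (i + 2) x * X.b (i + 2) y) * p (i + 2) +
      (X.a i x * X.b i y - X.b i x * X.a i y) * r i +
      (X.a (i + 1) x * X.b (i + 1) y - X.b (i + 1) x * X.a (i + 1) y) * r (i + 1) +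
      (X.a (i + 2) x * X.b (i + 2) y - X.b (i + 2) x * X.a (i + 2) y) * r (i + 2) = 0 := by
    intro p q r hr i
    obtain ⟨z, ha, hb, hc⟩ := X.surj p q r hr
    have hz := h z
    rw [X.form_eq i] at hz
    simp only [ha, hb, hc] at hz
    linear_combination hz
  have hne (i : Fin 3) : i + 1 ≠ i ∧ i + 2 ≠ i ∧ i + 2 ≠ i + 1 := by decide +revert
  have hab : ∀ i, X.a i x * X.b i y - X.b i x * X.a i y =
      X.a (i + 1) x * X.b (i + 1) y - X.b (i + 1) x * X.a (i + 1) y := by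
    intro i
    have := key 0 0 (Pi.single i 1 - Pi.single (i + 1) 1)
      (by fin_cases i <;> simp) i
    simp [hne] at this
    linear_combination this
  refine ⟨fun i => ?_, fun i => ?_, ?_⟩
  · have := key (Pi.single i 1) 0 0 (by simp) i
    simp [hne] at this
    linear_combination this
  · have := key 0 (Pi.single i 1) 0 (by simp) i
    simp [hne] at this
    linear_combination this
  · have h0 := hab 0
    have h2 := hab 2
    simp only [Fin.isValue, zero_add, Fin.reduceAdd] at h0 h2
    have h (i : Fin 3) : X.a i x * X.b i y - X.b i x * X.a i y =
        X.a 0 x * X.b 0 y - X.b 0 x * X.a 0 y := by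
      fin_cases i
      exacts [rfl, h0.symm, h2]
    exact fun i j => (h i).trans (h j).symm

theorem Contr.bb_one {x y : D} (h : X.Contr x y) (i : Fin 3) :
    X.b (i + 2) x * X.b i y - X.b i x * X.b (i + 2) y +
      (X.c (i + 1) x * X.a (i + 1) y - X.a (i + 1) x * X.c (i + 1) y) = 0 := by
  simpa only [Fin.three_add_one_add_one, Fin.three_add_one_add_two] using h.bb (i + 1)

theorem Contr.bb_two {x y : D} (h : X.Contr x y) (i : Fin 3) :
    X.b i x * X.b (i + 1) y - X.b (i + 1) x * X.b i y +
      (X.c (i + 2) x * X.a (i + 2) y - X.a (i + 2) x * X.c (i + 2) y) = 0 := by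
  simpa only [Fin.three_add_two_add_one, Fin.three_add_two_add_two] using h.bb (i + 2)

theorem eq_zero_of_rotate (i : Fin 3) {x : D}
    (ha : X.a i x = 0 ∧ X.a (i + 1) x = 0 ∧ X.a (i + 2) x = 0)
    (hb : X.b i x = 0 ∧ X.b (i + 1) x = 0 ∧ X.b (i + 2) x = 0)
    (hc : X.c i x = 0 ∧ X.c (i + 1) x = 0 ∧ X.c (i + 2) x = 0) : x = 0 :=
  X.inj x ((Fin.forall_three_iff i).2 ha) ((Fin.forall_three_iff i).2 hb)
    ((Fin.forall_three_iff i).2 hc)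

/-- As the `cᵢ` sum to zero, at least two of them are nonzero on `S` unless all vanish. -/
theorem exists_two_c_ne_zero {S : Submodule ℂ D} (h : ¬ ∀ x ∈ S, ∀ i, X.c i x = 0) :
    ∃ i, (∃ x ∈ S, X.c (i + 1) x ≠ 0) ∧ ∃ x ∈ S, X.c (i + 2) x ≠ 0 := by
  push Not at h
  obtain ⟨x, hx, l, hl⟩ := h
  by_cases h1 : X.c (l + 1) x = 0
  · refine ⟨l + 1, ⟨x, hx, ?_⟩, ⟨x, hx, by rwa [Fin.three_add_one_add_two]⟩⟩
    rw [Fin.three_add_one_add_one]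
    intro h2
    have := X.sum_c_rotate l x
    simp_all
  · exact ⟨l + 2, ⟨x, hx, by rwa [Fin.three_add_two_add_one]⟩,
      ⟨x, hx, by rwa [Fin.three_add_two_add_two]⟩⟩

theorem Contr.b_mul_b_eq {x y : D} (h : X.Contr x y) (hx : ∀ i, X.c i x = 0)
    (hy : ∀ i, X.c i y = 0) (i j : Fin 3) : X.b i x * X.b j y = X.b j x * X.b i y := by
  have h0 := h.bb 0
  have h1 := h.bb 1
  have h2 := h.bb 2
  simp [hx, hy] at h0 h1 h2
  fin_cases i <;> fin_cases j <;> simp <;> grind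

variable [FiniteDimensional ℂ D]

section IsotropicThreeSpace

variable {K L : Submodule ℂ D}

theorem c_eq_zero_of_contr (hK3 : Module.finrank ℂ K = 3)
    (hK : ∀ x ∈ K, ∀ y ∈ K, X.Contr x y) : ∀ x ∈ K, ∀ i, X.c i x = 0 := by
  by_contra hc
  obtain ⟨i, ⟨u, hu, hcu⟩, ⟨w, hw, hcw⟩⟩ := exists_two_c_ne_zero hc
  have hb1 : ∀ x ∈ K, X.c (i + 1) x = 0 → X.b (i + 1) x = 0 := fun x hx h => by
    simpa [h, hcu] using (hK x hx u hu).bc (i + 1)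
  have hb2 : ∀ x ∈ K, X.c (i + 2) x = 0 → X.b (i + 2) x = 0 := fun x hx h => by
    simpa [h, hcw] using (hK x hx w hw).bc (i + 2)
  by_cases h0 : ∃ y ∈ K, X.c i y ≠ 0
  · obtain ⟨y, hy, hcy⟩ := h0
    obtain ⟨x, hx, hx0, hf⟩ := exists_mem_ne_zero_of_lt_finrank K ![X.c i, X.c (i + 1)] (by omega)
    obtain ⟨c0, c1⟩ : X.c i x = 0 ∧ X.c (i + 1) x = 0 := by simpa [Fin.forall_fin_succ] using hf
    have c2 : X.c (i + 2) x = 0 := by simpa [c0, c1] using X.sum_c_rotate i x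
    have b0 : X.b i x = 0 := by simpa [c0, hcy] using (hK x hx y hy).bc i
    have b1 := hb1 x hx c1
    have b2 := hb2 x hx c2
    refine hx0 (eq_zero_of_rotate i ⟨?_, ?_, ?_⟩ ⟨b0, b1, b2⟩ ⟨c0, c1, c2⟩)
    · simpa [b1, b2, c0, hcy] using (hK x hx y hy).bb i
    · simpa [b0, b2, c1, hcu] using (hK x hx u hu).bb_one i
    · simpa [b0, b1, c2, hcw] using (hK x hx w hw).bb_two i
  · push Not at h0
    have hc2 : ∀ x ∈ K, X.c (i + 1) x = 0 → X.c (i + 2) x = 0 := fun x hx h => by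
      simpa [h, h0 x hx] using X.sum_c_rotate i x
    have ha : ∀ x ∈ K, X.c (i + 1) x = 0 → X.b i x = 0 →
        X.a (i + 1) x = 0 ∧ X.a (i + 2) x = 0 := fun x hx c1 b0 => by
      have c2 := hc2 x hx c1
      have b1 := hb1 x hx c1
      have b2 := hb2 x hx c2
      exact ⟨by simpa [b0, b2, c1, hcu] using (hK x hx u hu).bb_one i,
        by simpa [b0, b1, c2, hcw] using (hK x hx w hw).bb_two i⟩
    have hb0 : ∀ y ∈ K, X.b i y = 0 := by
      obtain ⟨x, hx, hx0, hf⟩ :=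
        exists_mem_ne_zero_of_lt_finrank K ![X.c (i + 1), X.b i] (by omega)
      obtain ⟨c1, b0⟩ : X.c (i + 1) x = 0 ∧ X.b i x = 0 := by simpa [Fin.forall_fin_succ] using hf
      have c2 := hc2 x hx c1
      obtain ⟨a1, a2⟩ := ha x hx c1 b0
      have a0 : X.a i x ≠ 0 := fun a0 => hx0 (eq_zero_of_rotate i ⟨a0, a1, a2⟩
        ⟨b0, hb1 x hx c1, hb2 x hx c2⟩ ⟨h0 x hx, c1, c2⟩)
      intro y hy
      simpa [a1, b0, hb1 x hx c1, a0] using (hK x hx y hy).ab i (i + 1)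
    obtain ⟨x, hx, hx0, hf⟩ := exists_mem_ne_zero_of_lt_finrank K ![X.c (i + 1), X.a i] (by omega)
    obtain ⟨c1, a0⟩ : X.c (i + 1) x = 0 ∧ X.a i x = 0 := by simpa [Fin.forall_fin_succ] using hf
    have c2 := hc2 x hx c1
    obtain ⟨a1, a2⟩ := ha x hx c1 (hb0 x hx)
    exact hx0 (eq_zero_of_rotate i ⟨a0, a1, a2⟩
      ⟨hb0 x hx, hb1 x hx c1, hb2 x hx c2⟩ ⟨h0 x hx, c1, c2⟩)

theorem b_eq_zero_or_of_contr (hK3 : Module.finrank ℂ K = 3)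
    (hK : ∀ x ∈ K, ∀ y ∈ K, X.Contr x y) {i j : Fin 3} (hij : i ≠ j) :
    (∀ x ∈ K, X.b i x = 0) ∨ ∀ x ∈ K, X.b j x = 0 := by
  have hc := c_eq_zero_of_contr hK3 hK
  by_contra! hb
  obtain ⟨⟨u, hu, hbu⟩, ⟨w, hw, hbw⟩⟩ := hb
  obtain ⟨k, hk⟩ := Fin.exists_third hij
  obtain ⟨x, hx, hx0, hf⟩ := exists_mem_ne_zero_of_lt_finrank K ![X.b i, X.a k] (by omega)
  obtain ⟨bi, ak⟩ : X.b i x = 0 ∧ X.a k x = 0 := by simpa [Fin.forall_fin_succ] using hf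
  have b0 : ∀ l, X.b l x = 0 := fun l => by
    simpa [bi, hbu] using (hK x hx u hu).b_mul_b_eq (hc x hx) (hc u hu) l i
  refine hx0 (X.inj x (fun l => ?_) b0 (hc x hx))
  rcases hk l with rfl | rfl | rfl
  · simpa [b0, ak, hbu] using (hK x hx u hu).ab l k
  · simpa [b0, ak, hbw] using (hK x hx w hw).ab l k
  · exact ak

theorem b_eq_zero_of_contr (hK3 : Module.finrank ℂ K = 3) (hL6 : Module.finrank ℂ L = 6)
    (hK : ∀ x ∈ K, ∀ y ∈ K, X.Contr x y)
    (hL : ∀ x ∈ K, ∀ y ∈ L, ∀ z ∈ L, X.form x y z = 0) : ∀ x ∈ K, ∀ i, X.b i x = 0 := by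
  have hc := c_eq_zero_of_contr hK3 hK
  by_contra! hb
  obtain ⟨u, hu, i, hbu⟩ := hb
  have hb1 : ∀ x ∈ K, X.b (i + 1) x = 0 :=
    (b_eq_zero_or_of_contr hK3 hK (Fin.three_add_one_ne i).symm).resolve_left fun h => hbu (h u hu)
  have hb2 : ∀ x ∈ K, X.b (i + 2) x = 0 :=
    (b_eq_zero_or_of_contr hK3 hK (Fin.three_add_two_ne i).symm).resolve_left fun h => hbu (h u hu)
  have ha : ∀ x ∈ K, X.b i x = 0 → X.a i x = 0 := fun x hx h => by
    simpa [h, hbu, hb1 x hx, hb1 u hu] using (hK x hx u hu).ab i (i + 1)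
  have hbc1 : ∀ y ∈ L, ∀ z ∈ L, X.b (i + 1) y * X.c (i + 1) z = X.c (i + 1) y * X.b (i + 1) z := by
    obtain ⟨x, hx, hx0, hf⟩ := exists_mem_ne_zero_of_lt_finrank K ![X.b i, X.a (i + 2)] (by omega)
    obtain ⟨b0, a2⟩ : X.b i x = 0 ∧ X.a (i + 2) x = 0 := by simpa [Fin.forall_fin_succ] using hf
    have a1 : X.a (i + 1) x ≠ 0 := fun a1 => hx0 (eq_zero_of_rotate i ⟨ha x hx b0, a1, a2⟩
      ⟨b0, hb1 x hx, hb2 x hx⟩ ⟨hc x hx _, hc x hx _, hc x hx _⟩)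
    intro y hy z hz
    have := hL x hx y hy z hz
    rw [X.form_eq i] at this
    simpa [hc x hx, hb1 x hx, hb2 x hx, b0, a2, ha x hx b0, a1, sub_eq_zero] using this
  have hbc2 : ∀ y ∈ L, ∀ z ∈ L, X.b (i + 2) y * X.c (i + 2) z = X.c (i + 2) y * X.b (i + 2) z := by
    obtain ⟨x, hx, hx0, hf⟩ := exists_mem_ne_zero_of_lt_finrank K ![X.b i, X.a (i + 1)] (by omega)
    obtain ⟨b0, a1⟩ : X.b i x = 0 ∧ X.a (i + 1) x = 0 := by simpa [Fin.forall_fin_succ] using hf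
    have a2 : X.a (i + 2) x ≠ 0 := fun a2 => hx0 (eq_zero_of_rotate i ⟨ha x hx b0, a1, a2⟩
      ⟨b0, hb1 x hx, hb2 x hx⟩ ⟨hc x hx _, hc x hx _, hc x hx _⟩)
    intro y hy z hz
    have := hL x hx y hy z hz
    rw [X.form_eq i] at this
    simpa [hc x hx, hb1 x hx, hb2 x hx, b0, a1, ha x hx b0, a2, sub_eq_zero] using this
  obtain ⟨s, t, hs, hbb⟩ : ∃ s t : ℂ, s ≠ 0 ∧ ∀ y ∈ L, ∀ z ∈ L,
      s * (X.b (i + 1) y * X.b (i + 2) z - X.b (i + 2) y * X.b (i + 1) z +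
        (X.c i y * X.a i z - X.a i y * X.c i z)) +
      t * (X.b i y * X.c i z - X.c i y * X.b i z) = 0 := by
    obtain ⟨x, hx, hx0, hf⟩ :=
      exists_mem_ne_zero_of_lt_finrank K ![X.a (i + 1), X.a (i + 2)] (by omega)
    obtain ⟨a1, a2⟩ : X.a (i + 1) x = 0 ∧ X.a (i + 2) x = 0 := by
      simpa [Fin.forall_fin_succ] using hf
    refine ⟨X.b i x, X.a i x, fun b0 => hx0 (eq_zero_of_rotate i ⟨ha x hx b0, a1, a2⟩
      ⟨b0, hb1 x hx, hb2 x hx⟩ ⟨hc x hx _, hc x hx _, hc x hx _⟩), fun y hy z hz => ?_⟩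
    have := hL x hx y hy z hz
    rw [X.form_eq i] at this
    simpa [hc x hx, hb1 x hx, hb2 x hx, a1, a2] using this
  -- It suffices to kill `aᵢ, bᵢ₊₁, bᵢ₊₂, cᵢ₊₁, cᵢ₊₂` on `L` by two functionals.
  have key : ∀ f g : Module.Dual ℂ D, ¬ ∀ x ∈ L, f x = 0 → g x = 0 → X.b i x = 0 →
      X.a i x = 0 ∧ X.b (i + 1) x = 0 ∧ X.b (i + 2) x = 0 ∧
        X.c (i + 1) x = 0 ∧ X.c (i + 2) x = 0 := by
    intro f g h
    obtain ⟨x, hx, hx0, hf⟩ := exists_mem_ne_zero_of_lt_finrank L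
      ![X.a (i + 1), X.a (i + 2), X.b i, f, g] (by omega)
    obtain ⟨a1, a2, b0, hfx, hgx⟩ : X.a (i + 1) x = 0 ∧ X.a (i + 2) x = 0 ∧ X.b i x = 0 ∧
      f x = 0 ∧ g x = 0 := by simpa [Fin.forall_fin_succ] using hf
    obtain ⟨a0, b1, b2, c1, c2⟩ := h x hx hfx hgx b0
    have c0 : X.c i x = 0 := by simpa [c1, c2] using X.sum_c_rotate i x
    exact hx0 (eq_zero_of_rotate i ⟨a0, a1, a2⟩ ⟨b0, b1, b2⟩ ⟨c0, c1, c2⟩)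
  by_cases h1 : ∃ y ∈ L, X.c (i + 1) y ≠ 0 <;> by_cases h2 : ∃ y ∈ L, X.c (i + 2) y ≠ 0
  · obtain ⟨y, hy, hcy⟩ := h1
    obtain ⟨z, hz, hcz⟩ := h2
    have hb1 : ∀ x ∈ L, X.c (i + 1) x = 0 → X.b (i + 1) x = 0 := fun x hx h => by
      simpa [h, hcy] using hbc1 x hx y hy
    have hb2 : ∀ x ∈ L, X.c (i + 2) x = 0 → X.b (i + 2) x = 0 := fun x hx h => by
      simpa [h, hcz] using hbc2 x hx z hz
    by_cases h0 : ∃ w ∈ L, X.c i w ≠ 0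
    · obtain ⟨w, hw, hcw⟩ := h0
      refine key (X.c (i + 1)) (X.c (i + 2)) fun x hx c1 c2 b0 => ?_
      have c0 : X.c i x = 0 := by simpa [c1, c2] using X.sum_c_rotate i x
      have b1 := hb1 x hx c1
      have b2 := hb2 x hx c2
      refine ⟨?_, b1, b2, c1, c2⟩
      simpa [b0, b1, b2, c0, hcw, hs] using hbb x hx w hw
    · push Not at h0
      refine key (X.c (i + 1)) (X.a i) fun x hx c1 a0 b0 => ?_
      have c2 : X.c (i + 2) x = 0 := by simpa [c1, h0 x hx] using X.sum_c_rotate i x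
      exact ⟨a0, hb1 x hx c1, hb2 x hx c2, c1, c2⟩
  · push Not at h2
    obtain ⟨y, hy, hcy⟩ := h1
    have hc0 : X.c i y ≠ 0 := fun h0 => hcy (by simpa [h0, h2 y hy] using X.sum_c_rotate i y)
    refine key (X.c (i + 1)) (X.b (i + 2)) fun x hx c1 b2 b0 => ?_
    have c0 : X.c i x = 0 := by simpa [c1, h2 x hx] using X.sum_c_rotate i x
    have b1 : X.b (i + 1) x = 0 := by simpa [c1, hcy] using hbc1 x hx y hy
    refine ⟨?_, b1, b2, c1, h2 x hx⟩
    simpa [b0, b1, b2, c0, hc0, hs] using hbb x hx y hy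
  · push Not at h1
    obtain ⟨y, hy, hcy⟩ := h2
    have hc0 : X.c i y ≠ 0 := fun h0 => hcy (by simpa [h0, h1 y hy] using X.sum_c_rotate i y)
    refine key (X.c (i + 2)) (X.b (i + 1)) fun x hx c2 b1 b0 => ?_
    have c0 : X.c i x = 0 := by simpa [c2, h1 x hx] using X.sum_c_rotate i x
    have b2 : X.b (i + 2) x = 0 := by simpa [c2, hcy] using hbc2 x hx y hy
    refine ⟨?_, b1, b2, h1 x hx, c2⟩
    simpa [b0, b1, b2, c0, hc0, hs] using hbb x hx y hy
  · push Not at h1 h2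
    have c0 : ∀ x ∈ L, X.c i x = 0 := fun x hx => by
      simpa [h1 x hx, h2 x hx] using X.sum_c_rotate i x
    by_cases h : ∃ y ∈ L, X.b (i + 1) y ≠ 0
    · obtain ⟨y, hy, hby⟩ := h
      refine key (X.a i) (X.b (i + 1)) fun x hx a0 b1 b0 => ⟨a0, b1, ?_, h1 x hx, h2 x hx⟩
      simpa [b1, c0 x hx, c0 y hy, hby, hs] using hbb x hx y hy
    · push Not at h
      exact key (X.a i) (X.b (i + 2)) fun x hx a0 b2 b0 => ⟨a0, h x hx, b2, h1 x hx, h2 x hx⟩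

/-- The three-dimensional subspace `K` is cut out by the coordinates `bᵢ` and `cᵢ`. -/
theorem mem_iff_of_contr (hK3 : Module.finrank ℂ K = 3) (hL6 : Module.finrank ℂ L = 6)
    (hK : ∀ x ∈ K, ∀ y ∈ K, X.Contr x y)
    (hL : ∀ x ∈ K, ∀ y ∈ L, ∀ z ∈ L, X.form x y z = 0) (x : D) :
    x ∈ K ↔ (∀ i, X.b i x = 0) ∧ ∀ i, X.c i x = 0 := by
  have hb := b_eq_zero_of_contr hK3 hL6 hK hL
  have hc := c_eq_zero_of_contr hK3 hK
  refine ⟨fun hx => ⟨hb x hx, hc x hx⟩, fun hx => ?_⟩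
  let S : Submodule ℂ D := (⨅ i, LinearMap.ker (X.b i)) ⊓ ⨅ i, LinearMap.ker (X.c i)
  have hS : ∀ z, z ∈ S ↔ (∀ i, X.b i z = 0) ∧ ∀ i, X.c i z = 0 := fun z => by simp [S]
  have hKS : K ≤ S := fun z hz => (hS z).2 ⟨hb z hz, hc z hz⟩
  rw [Submodule.eq_of_le_of_finrank_le hKS, hS]
  · exact hx
  · rw [hK3]
    exact finrank_le_of_forall_eq_zero S X.a fun z hz ha =>
      X.inj z ha ((hS z).1 hz).1 ((hS z).1 hz).2

/-- The six-dimensional subspace `L` is cut out by the coordinates `cᵢ`. -/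
theorem mem_iff_of_form_eq_zero (hK3 : Module.finrank ℂ K = 3) (hL6 : Module.finrank ℂ L = 6)
    (hK : ∀ x ∈ K, ∀ y ∈ K, X.Contr x y)
    (hL : ∀ x ∈ K, ∀ y ∈ L, ∀ z ∈ L, X.form x y z = 0) (x : D) :
    x ∈ L ↔ ∀ i, X.c i x = 0 := by
  have hmem := mem_iff_of_contr hK3 hL6 hK hL
  have hbc : ∀ i, ∀ y ∈ L, ∀ z ∈ L, X.b i y * X.c i z = X.c i y * X.b i z := by
    intro i y hy z hz
    obtain ⟨x, ha, hb, hc⟩ := X.surj (Pi.single i 1) 0 0 (by simp)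
    have := hL x ((hmem x).2 ⟨hb, hc⟩) y hy z hz
    rw [X.form_eq i] at this
    simpa [ha, hb, hc, Fin.three_add_one_ne, Fin.three_add_two_ne, sub_eq_zero] using this
  have hcL : ∀ x ∈ L, ∀ i, X.c i x = 0 := by
    by_contra hc
    obtain ⟨i, ⟨u, hu, hcu⟩, ⟨w, hw, hcw⟩⟩ := exists_two_c_ne_zero hc
    have key : ∀ f g : Module.Dual ℂ D, ¬ ∀ x ∈ L, f x = 0 → g x = 0 →
        X.b i x = 0 ∧ X.c (i + 1) x = 0 ∧ X.c (i + 2) x = 0 := by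
      intro f g h
      obtain ⟨x, hx, hx0, hf⟩ := exists_mem_ne_zero_of_lt_finrank L
        ![X.a i, X.a (i + 1), X.a (i + 2), f, g] (by omega)
      obtain ⟨a0, a1, a2, hfx, hgx⟩ : X.a i x = 0 ∧ X.a (i + 1) x = 0 ∧ X.a (i + 2) x = 0 ∧
        f x = 0 ∧ g x = 0 := by simpa [Fin.forall_fin_succ] using hf
      obtain ⟨b0, c1, c2⟩ := h x hx hfx hgx
      have c0 : X.c i x = 0 := by simpa [c1, c2] using X.sum_c_rotate i x
      have b1 : X.b (i + 1) x = 0 := by simpa [c1, hcu] using hbc (i + 1) x hx u hu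
      have b2 : X.b (i + 2) x = 0 := by simpa [c2, hcw] using hbc (i + 2) x hx w hw
      exact hx0 (eq_zero_of_rotate i ⟨a0, a1, a2⟩ ⟨b0, b1, b2⟩ ⟨c0, c1, c2⟩)
    by_cases h0 : ∃ y ∈ L, X.c i y ≠ 0
    · obtain ⟨y, hy, hcy⟩ := h0
      refine key (X.c (i + 1)) (X.c (i + 2)) fun x hx c1 c2 => ⟨?_, c1, c2⟩
      have c0 : X.c i x = 0 := by simpa [c1, c2] using X.sum_c_rotate i x
      simpa [c0, hcy] using hbc i x hx y hy
    · push Not at h0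
      refine key (X.c (i + 1)) (X.b i) fun x hx c1 b0 => ⟨b0, c1, ?_⟩
      simpa [c1, h0 x hx] using X.sum_c_rotate i x
  refine ⟨fun hx => hcL x hx, fun hx => ?_⟩
  let S : Submodule ℂ D := ⨅ i, LinearMap.ker (X.c i)
  have hS : ∀ z, z ∈ S ↔ ∀ i, X.c i z = 0 := fun z => by simp [S]
  have hLS : L ≤ S := fun z hz => (hS z).2 (hcL z hz)
  rw [Submodule.eq_of_le_of_finrank_le hLS, hS]
  · exact hx
  · rw [hL6]
    refine finrank_le_of_forall_eq_zero S ![X.a 0, X.a 1, X.a 2, X.b 0, X.b 1, X.b 2]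
      fun z hz h => ?_
    obtain ⟨a0, a1, a2, b0, b1, b2⟩ : X.a 0 z = 0 ∧ X.a 1 z = 0 ∧ X.a 2 z = 0 ∧
      X.b 0 z = 0 ∧ X.b 1 z = 0 ∧ X.b 2 z = 0 := by simpa [Fin.forall_fin_succ] using h
    exact eq_zero_of_rotate 0 ⟨a0, a1, a2⟩ ⟨b0, b1, b2⟩
      ⟨(hS z).1 hz _, (hS z).1 hz _, (hS z).1 hz _⟩

end IsotropicThreeSpace

section IsotropicTwoSpace

variable {N M : Submodule ℂ D}

theorem c_eq_zero_of_form_eq_zero (hM4 : Module.finrank ℂ M = 4)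
    (hN : ∀ x ∈ N, ∀ y ∈ M, X.Contr x y)
    (hM : ∀ x ∈ M, ∀ y ∈ M, ∀ z ∈ M, X.form x y z = 0) : ∀ x ∈ N, ∀ i, X.c i x = 0 := by
  intro u hu
  by_contra! hc
  obtain ⟨l, hl⟩ := hc
  by_cases hall : ∀ i, X.c i u ≠ 0
  · obtain ⟨x, hx, hx0, hf⟩ := exists_mem_ne_zero_of_lt_finrank M ![X.c 0, X.c 1] (by omega)
    obtain ⟨c0, c1⟩ : X.c 0 x = 0 ∧ X.c 1 x = 0 := by simpa [Fin.forall_fin_succ] using hf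
    have c2 : X.c 2 x = 0 := by simpa [c0, c1] using X.sum_c x
    have hc : ∀ i, X.c i x = 0 := (Fin.forall_three_iff 0).2 ⟨c0, c1, c2⟩
    have hb : ∀ i, X.b i x = 0 := fun i => by simpa [hc, hall] using (hN u hu x hx).bc i
    exact hx0 (X.inj x (fun i => by simpa [hb, hc, hall] using (hN u hu x hx).bb i) hb hc)
  push Not at hall
  obtain ⟨i, u0⟩ := hall
  have hsum := X.sum_c_rotate i u
  have u1 : X.c (i + 1) u ≠ 0 := fun u1 =>
    hl ((Fin.forall_three_iff (P := fun j => X.c j u = 0) i).2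
      ⟨u0, u1, by simpa [u0, u1] using hsum⟩ l)
  have u2 : X.c (i + 2) u ≠ 0 := fun u2 => u1 (by simpa [u0, u2] using hsum)
  have hb : ∀ x ∈ M, X.c (i + 1) x = 0 → X.c (i + 2) x = 0 →
      X.b (i + 1) x = 0 ∧ X.b (i + 2) x = 0 := fun x hx c1 c2 =>
    ⟨by simpa [c1, u1] using (hN u hu x hx).bc (i + 1),
      by simpa [c2, u2] using (hN u hu x hx).bc (i + 2)⟩
  have ha : ∀ x ∈ M, X.c (i + 1) x = 0 → X.c (i + 2) x = 0 → X.b i x = 0 →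
      X.a (i + 1) x = 0 ∧ X.a (i + 2) x = 0 := fun x hx c1 c2 b0 => by
    obtain ⟨b1, b2⟩ := hb x hx c1 c2
    exact ⟨by simpa [b0, b2, c1, u1] using (hN u hu x hx).bb_one i,
      by simpa [b0, b1, c2, u2] using (hN u hu x hx).bb_two i⟩
  have hinj : ∀ x ∈ M, X.c (i + 1) x = 0 → X.c (i + 2) x = 0 → X.b i x = 0 → X.a i x = 0 →
      x = 0 := fun x hx c1 c2 b0 a0 => by
    obtain ⟨b1, b2⟩ := hb x hx c1 c2
    obtain ⟨a1, a2⟩ := ha x hx c1 c2 b0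
    exact eq_zero_of_rotate i ⟨a0, a1, a2⟩ ⟨b0, b1, b2⟩
      ⟨by simpa [c1, c2] using X.sum_c_rotate i x, c1, c2⟩
  have hc0 : ∀ z ∈ M, X.c i z = 0 := by
    obtain ⟨x, hx, hx0, hf⟩ :=
      exists_mem_ne_zero_of_lt_finrank M ![X.c (i + 1), X.c (i + 2), X.b i] (by omega)
    obtain ⟨c1, c2, b0⟩ : X.c (i + 1) x = 0 ∧ X.c (i + 2) x = 0 ∧ X.b i x = 0 := by
      simpa [Fin.forall_fin_succ] using hf
    obtain ⟨y, hy, hy0, hf'⟩ :=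
      exists_mem_ne_zero_of_lt_finrank M ![X.c (i + 1), X.c (i + 2), X.a i] (by omega)
    obtain ⟨d1, d2, a0⟩ : X.c (i + 1) y = 0 ∧ X.c (i + 2) y = 0 ∧ X.a i y = 0 := by
      simpa [Fin.forall_fin_succ] using hf'
    have hax : X.a i x ≠ 0 := fun a0 => hx0 (hinj x hx c1 c2 b0 a0)
    have hby : X.b i y ≠ 0 := fun b0 => hy0 (hinj y hy d1 d2 b0 a0)
    have c0 : X.c i x = 0 := by simpa [c1, c2] using X.sum_c_rotate i x
    have d0 : X.c i y = 0 := by simpa [d1, d2] using X.sum_c_rotate i y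
    obtain ⟨b1, b2⟩ := hb x hx c1 c2
    obtain ⟨a1, a2⟩ := ha x hx c1 c2 b0
    intro z hz
    have := hM x hx y hy z hz
    rw [X.form_eq i] at this
    simpa [a1, a2, b0, b1, b2, c0, c1, c2, d0, hax, hby] using this
  obtain ⟨x, hx, hx0, hf⟩ :=
    exists_mem_ne_zero_of_lt_finrank M ![X.c (i + 1), X.b i, X.a i] (by omega)
  obtain ⟨c1, b0, a0⟩ : X.c (i + 1) x = 0 ∧ X.b i x = 0 ∧ X.a i x = 0 := by
    simpa [Fin.forall_fin_succ] using hf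
  exact hx0 (hinj x hx c1 (by simpa [c1, hc0 x hx] using X.sum_c_rotate i x) b0 a0)

theorem b_eq_zero_of_form_eq_zero (hN2 : Module.finrank ℂ N = 2) (hM4 : Module.finrank ℂ M = 4)
    (hNM : N ≤ M) (hN : ∀ x ∈ N, ∀ y ∈ M, X.Contr x y)
    (hM : ∀ x ∈ M, ∀ y ∈ M, ∀ z ∈ M, X.form x y z = 0) : ∀ x ∈ N, ∀ i, X.b i x = 0 := by
  have hc := c_eq_zero_of_form_eq_zero hM4 hN hM
  have hpair : ∀ x ∈ N, ∀ i j, i ≠ j → X.b i x = 0 ∨ X.b j x = 0 := by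
    intro u hu i j hij
    by_contra! hb
    obtain ⟨hbi, hbj⟩ := hb
    have hcij : ∀ y ∈ M, X.c i y = 0 ∧ X.c j y = 0 := fun y hy =>
      ⟨by simpa [hc u hu, hbi] using (hN u hu y hy).bc i,
        by simpa [hc u hu, hbj] using (hN u hu y hy).bc j⟩
    have hcM : ∀ y ∈ M, ∀ l, X.c l y = 0 := by
      intro y hy
      obtain ⟨h1, h2⟩ := hcij y hy
      have := X.sum_c y
      have h3 : ∀ l, X.c l y = 0 := by
        fin_cases i <;> fin_cases j <;> simp_all [Fin.forall_fin_succ]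
      exact h3
    obtain ⟨k, hk⟩ := Fin.exists_third hij
    obtain ⟨x, hx, hx0, hf⟩ := exists_mem_ne_zero_of_lt_finrank M ![X.b i, X.a i, X.a k] (by omega)
    obtain ⟨b0, ai, ak⟩ : X.b i x = 0 ∧ X.a i x = 0 ∧ X.a k x = 0 := by
      simpa [Fin.forall_fin_succ] using hf
    have hb : ∀ l, X.b l x = 0 := fun l => by
      simpa [b0, hbi] using (hN u hu x hx).b_mul_b_eq (hc u hu) (hcM x hx) i l
    refine hx0 (X.inj x (fun l => ?_) hb (hcM x hx))
    rcases hk l with rfl | rfl | rfl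
    · exact ai
    · simpa [hb, ai, hbj] using (hN u hu x hx).ab l i
    · exact ak
  intro u hu
  by_contra! hb
  obtain ⟨i, u0⟩ := hb
  have u1 : X.b (i + 1) u = 0 := (hpair u hu _ _ (Fin.three_add_one_ne i).symm).resolve_left u0
  have u2 : X.b (i + 2) u = 0 := (hpair u hu _ _ (Fin.three_add_two_ne i).symm).resolve_left u0
  obtain ⟨w, hw, hw0, hf⟩ := exists_mem_ne_zero_of_lt_finrank N ![X.b i] (by omega)
  have w0 : X.b i w = 0 := by simpa using hf
  have w1 : X.b (i + 1) w = 0 := by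
    simpa [w0, u0, u1] using hpair (u + w) (N.add_mem hu hw) _ _ (Fin.three_add_one_ne i).symm
  have w2 : X.b (i + 2) w = 0 := by
    simpa [w0, u0, u2] using hpair (u + w) (N.add_mem hu hw) _ _ (Fin.three_add_two_ne i).symm
  have wa0 : X.a i w = 0 := by
    simpa [w0, w1, u0, u1] using (hN u hu w (hNM hw)).ab i (i + 1)
  have hc0 : ∀ y ∈ M, X.c i y = 0 := fun y hy => by
    simpa [hc u hu, u0] using (hN u hu y hy).bc i
  have hcM : ∀ y ∈ M, X.c (i + 1) y = 0 ∧ X.c (i + 2) y = 0 := by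
    intro y hy
    have hsum := X.sum_c_rotate i y
    rw [hc0 y hy, zero_add] at hsum
    by_cases wa1 : X.a (i + 1) w = 0
    · have wa2 : X.a (i + 2) w ≠ 0 := fun wa2 => hw0 (eq_zero_of_rotate i ⟨wa0, wa1, wa2⟩
        ⟨w0, w1, w2⟩ ⟨hc w hw _, hc w hw _, hc w hw _⟩)
      have c2 : X.c (i + 2) y = 0 := by
        simpa [w0, w1, hc w hw, wa2] using (hN w hw y hy).bb_two i
      exact ⟨by simpa [c2] using hsum, c2⟩
    · have c1 : X.c (i + 1) y = 0 := by
        simpa [w0, w2, hc w hw, wa1] using (hN w hw y hy).bb_one i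
      exact ⟨c1, by simpa [c1] using hsum⟩
  obtain ⟨x, hx, hx0, hf⟩ :=
    exists_mem_ne_zero_of_lt_finrank M ![X.b i, X.a (i + 1), X.a (i + 2)] (by omega)
  obtain ⟨b0, a1, a2⟩ : X.b i x = 0 ∧ X.a (i + 1) x = 0 ∧ X.a (i + 2) x = 0 := by
    simpa [Fin.forall_fin_succ] using hf
  obtain ⟨c1, c2⟩ := hcM x hx
  have b1 : X.b (i + 1) x = 0 := by
    simpa [u1, c2, hc u hu, u0] using (hN u hu x hx).bb_two i
  have b2 : X.b (i + 2) x = 0 := by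
    simpa [u2, c1, hc u hu, u0] using (hN u hu x hx).bb_one i
  have a0 : X.a i x = 0 := by
    simpa [u1, b0, b1, a1, u0] using (hN u hu x hx).ab i (i + 1)
  exact hx0 (eq_zero_of_rotate i ⟨a0, a1, a2⟩ ⟨b0, b1, b2⟩ ⟨hc0 x hx, c1, c2⟩)

theorem c_eq_zero_of_mem_of_form_eq_zero (hN2 : Module.finrank ℂ N = 2)
    (hM4 : Module.finrank ℂ M = 4) (hNM : N ≤ M) (hN : ∀ x ∈ N, ∀ y ∈ M, X.Contr x y)
    (hM : ∀ x ∈ M, ∀ y ∈ M, ∀ z ∈ M, X.form x y z = 0) : ∀ x ∈ M, ∀ i, X.c i x = 0 := by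
  have hc := c_eq_zero_of_form_eq_zero hM4 hN hM
  have hb := b_eq_zero_of_form_eq_zero hN2 hM4 hNM hN hM
  by_contra h
  obtain ⟨i, ⟨u, hu, hcu⟩, ⟨w, hw, hcw⟩⟩ := exists_two_c_ne_zero h
  obtain ⟨x, hx, hx0, hf⟩ := exists_mem_ne_zero_of_lt_finrank N ![X.a i] (by omega)
  have a0 : X.a i x = 0 := by simpa using hf
  refine hx0 (X.inj x ((Fin.forall_three_iff i).2 ⟨a0, ?_, ?_⟩) (hb x hx) (hc x hx))
  · simpa [hb x hx, hc x hx, hcu] using (hN x hx u hu).bb (i + 1)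
  · simpa [hb x hx, hc x hx, hcw] using (hN x hx w hw).bb (i + 2)

/-- The four-dimensional subspace `M` contains the common kernel of the `bᵢ` and `cᵢ`. -/
theorem mem_of_form_eq_zero (hN2 : Module.finrank ℂ N = 2)
    (hM4 : Module.finrank ℂ M = 4) (hNM : N ≤ M) (hN : ∀ x ∈ N, ∀ y ∈ M, X.Contr x y)
    (hM : ∀ x ∈ M, ∀ y ∈ M, ∀ z ∈ M, X.form x y z = 0) {x : D} (hxb : ∀ i, X.b i x = 0)
    (hxc : ∀ i, X.c i x = 0) : x ∈ M := by
  have hc := c_eq_zero_of_form_eq_zero hM4 hN hM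
  have hb := b_eq_zero_of_form_eq_zero hN2 hM4 hNM hN hM
  have hcM := c_eq_zero_of_mem_of_form_eq_zero hN2 hM4 hNM hN hM
  have hpair : ∀ i, (∀ y ∈ M, X.b (i + 1) y = 0) ∨ ∀ y ∈ M, X.b (i + 2) y = 0 := by
    intro i
    obtain ⟨w, hw, hw0, hf⟩ := exists_mem_ne_zero_of_lt_finrank N ![X.a i] (by omega)
    have a0 : X.a i w = 0 := by simpa using hf
    by_cases a1 : X.a (i + 1) w = 0
    · have a2 : X.a (i + 2) w ≠ 0 := fun a2 =>
        hw0 (X.inj w ((Fin.forall_three_iff i).2 ⟨a0, a1, a2⟩) (hb w hw) (hc w hw))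
      exact .inr fun y hy => by simpa [a0, a2, hb w hw] using (hN w hw y hy).ab (i + 2) i
    · exact .inl fun y hy => by simpa [a0, a1, hb w hw] using (hN w hw y hy).ab (i + 1) i
  obtain ⟨i, h1, h2⟩ : ∃ i, (∀ y ∈ M, X.b (i + 1) y = 0) ∧ ∀ y ∈ M, X.b (i + 2) y = 0 := by
    have p0 := hpair 0
    have p1 := hpair 1
    have p2 := hpair 2
    simp only [Fin.isValue, zero_add, Fin.reduceAdd] at p0 p1 p2
    simp only [Fin.exists_fin_succ, Fin.isValue]
    simp
    tauto
  let S : Submodule ℂ D := (LinearMap.ker (X.b (i + 1)) ⊓ LinearMap.ker (X.b (i + 2))) ⊓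
    ⨅ i, LinearMap.ker (X.c i)
  have hS : ∀ z, z ∈ S ↔ (X.b (i + 1) z = 0 ∧ X.b (i + 2) z = 0) ∧ ∀ i, X.c i z = 0 :=
    fun z => by simp [S]
  have hMS : M ≤ S := fun z hz => (hS z).2 ⟨⟨h1 z hz, h2 z hz⟩, hcM z hz⟩
  rw [Submodule.eq_of_le_of_finrank_le hMS, hS]
  · exact ⟨⟨hxb _, hxb _⟩, hxc⟩
  · rw [hM4]
    refine finrank_le_of_forall_eq_zero S ![X.a 0, X.a 1, X.a 2, X.b i] fun z hz h => ?_
    obtain ⟨a0, a1, a2, b0⟩ : X.a 0 z = 0 ∧ X.a 1 z = 0 ∧ X.a 2 z = 0 ∧ X.b i z = 0 := by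
      simpa [Fin.forall_fin_succ] using h
    obtain ⟨⟨b1, b2⟩, hcz⟩ := (hS z).1 hz
    exact X.inj z ((Fin.forall_three_iff 0).2 ⟨a0, a1, a2⟩)
      ((Fin.forall_three_iff i).2 ⟨b0, b1, b2⟩) hcz

end IsotropicTwoSpace

end AdaptedCoords

/-- Evaluation of an element of the exterior algebra on three functionals. -/
def evalThree (α β γ : Module.Dual ℂ V8) : ExteriorAlgebra ℂ V8 →ₗ[ℂ] ℂ :=
  ExteriorAlgebra.algebraMapInv.toLinearMap ∘ₗ CliffordAlgebra.contractLeft γ ∘ₗ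
    CliffordAlgebra.contractLeft β ∘ₗ CliffordAlgebra.contractLeft α

theorem evalThree_ι_mul (α β γ : Module.Dual ℂ V8) (s t u : V8) :
    evalThree α β γ (ι ℂ s * ι ℂ t * ι ℂ u) =
      !![α s, α t, α u; β s, β t, β u; γ s, γ t, γ u].det := by
  have h : ExteriorAlgebra.algebraMapInv (CliffordAlgebra.contractLeft γ
      (CliffordAlgebra.contractLeft β (CliffordAlgebra.contractLeft α
        (CliffordAlgebra.ι (0 : QuadraticForm ℂ V8) s *
          (CliffordAlgebra.ι 0 t * CliffordAlgebra.ι 0 u))))) =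
      !![α s, α t, α u; β s, β t, β u; γ s, γ t, γ u].det := by
    simp only [CliffordAlgebra.contractLeft_ι_mul, CliffordAlgebra.contractLeft_ι, map_sub,
      map_smul, CliffordAlgebra.contractLeft_algebraMap, Matrix.det_fin_three]
    simp [ExteriorAlgebra.algebraMapInv]
    ring
  rw [mul_assoc]
  exact h

theorem evalThree_eq_zero {α β γ : Module.Dual ℂ V8} {S T U : Submodule ℂ V8}
    (h : ∀ s ∈ S, ∀ t ∈ T, ∀ u ∈ U,
      !![α s, α t, α u; β s, β t, β u; γ s, γ t, γ u].det = 0) :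
    wSpan S T U ≤ LinearMap.ker (evalThree α β γ) := by
  rw [wSpan, Submodule.span_le]
  rintro _ ⟨s, hs, t, ht, u, hu, rfl⟩
  exact (evalThree_ι_mul α β γ s t u).trans (h s hs t ht u hu)

/-- Three functionals vanishing on `U₄` are dependent on `U₆` if `U₆ / U₄` is a plane. -/
theorem det_eq_zero_of_mem_dualAnnihilator {U₄ U₆ : Submodule ℂ V8}
    (hU : Module.finrank ℂ U₆ < Module.finrank ℂ U₄ + 3) (hU46 : U₄ ≤ U₆)
    {α β γ : Module.Dual ℂ V8} (hα : α ∈ U₄.dualAnnihilator) (hβ : β ∈ U₄.dualAnnihilator)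
    (hγ : γ ∈ U₄.dualAnnihilator) {s t u : V8} (hs : s ∈ U₆) (ht : t ∈ U₆) (hu : u ∈ U₆) :
    !![α s, α t, α u; β s, β t, β u; γ s, γ t, γ u].det = 0 := by
  rw [Submodule.mem_dualAnnihilator] at hα hβ hγ
  let φ : (Fin 3 → ℂ) × U₄ →ₗ[ℂ] U₆ :=
    (Fintype.linearCombination ℂ ![(⟨s, hs⟩ : U₆), ⟨t, ht⟩, ⟨u, hu⟩]).coprod
      (Submodule.inclusion hU46)
  have hk : LinearMap.ker φ ≠ ⊥ := LinearMap.ker_ne_bot_of_finrank_lt (by simp; omega)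
  obtain ⟨⟨p, w⟩, hx, hx0⟩ := Submodule.exists_mem_ne_zero_of_ne_bot hk
  have hrel : p 0 • s + p 1 • t + p 2 • u + (w : V8) = 0 := by
    simpa [φ, Fintype.linearCombination_apply, Fin.sum_univ_three] using
      congrArg (Subtype.val : U₆ → V8) (LinearMap.mem_ker.1 hx)
  have hp : p ≠ 0 := by
    rintro rfl
    apply hx0
    simpa using hrel
  refine Matrix.exists_mulVec_eq_zero_iff.1 ⟨p, hp, ?_⟩
  have key : ∀ δ : Module.Dual ℂ V8, (∀ w ∈ U₄, δ w = 0) →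
      δ s * p 0 + δ t * p 1 + δ u * p 2 = 0 := fun δ hδ => by
    have := congrArg δ hrel
    simp only [map_add, map_smul, smul_eq_mul, hδ w w.2, map_zero] at this
    linear_combination this
  ext i
  fin_cases i
  · simpa [Matrix.mulVec, dotProduct, Fin.sum_univ_three] using key α hα
  · simpa [Matrix.mulVec, dotProduct, Fin.sum_univ_three] using key β hβ
  · simpa [Matrix.mulVec, dotProduct, Fin.sum_univ_three] using key γ hγ

/-- The functionals on `V₈` in coordinates adapted to `⋀³g (y₄)`. -/
def y4Coords (g : V8 ≃ₗ[ℂ] V8) : AdaptedCoords (Module.Dual ℂ V8) where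
  a := ![Module.Dual.eval ℂ V8 (g (v 0)),
    Module.Dual.eval ℂ V8 (g ((1 / 2 : ℂ) • (v 1 + v 2))),
    Module.Dual.eval ℂ V8 (g ((1 / 2 : ℂ) • (v 1 - v 2)))]
  b := ![Module.Dual.eval ℂ V8 (g ((-1 / 2 : ℂ) • v 3)), Module.Dual.eval ℂ V8 (g (v 4 + v 5)),
    Module.Dual.eval ℂ V8 (g (v 4 - v 5))]
  c := ![Module.Dual.eval ℂ V8 (g ((-2 : ℂ) • v 6)), Module.Dual.eval ℂ V8 (g (v 6 + v 7)),
    Module.Dual.eval ℂ V8 (g (v 6 - v 7))]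
  sum_c x := by simp; ring
  inj x ha hb hc := by
    simp [Fin.forall_fin_succ] at ha hb hc
    have hx : x.comp (g : V8 →ₗ[ℂ] V8) = 0 := by
      refine (Pi.basisFun ℂ (Fin 8)).ext fun i => ?_
      suffices x (g (v i)) = 0 by simpa [v] using this
      fin_cases i <;> simp <;> grind
    refine LinearMap.ext fun z => ?_
    simpa using LinearMap.congr_fun hx (g.symm z)
  surj p q r hr := by
    refine ⟨(Fintype.linearCombination ℂ ![p 0, p 1 + p 2, p 1 - p 2, -2 * q 0, (q 1 + q 2) / 2,
      (q 1 - q 2) / 2, (r 1 + r 2) / 2, (r 1 - r 2) / 2]).comp (g.symm : V8 →ₗ[ℂ] V8), ?_⟩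
    simp [Fin.forall_fin_succ, v, Fintype.linearCombination_apply, Pi.single_apply]
    grind

theorem evalThree_map_y4 (g : V8 ≃ₗ[ℂ] V8) (α β γ : Module.Dual ℂ V8) :
    evalThree α β γ (ExteriorAlgebra.map (g : V8 →ₗ[ℂ] V8) y4) = (y4Coords g).form α β γ := by
  simp only [y4, map_add, map_mul, ExteriorAlgebra.map_apply_ι, evalThree_ι_mul]
  simp [AdaptedCoords.form, y4Coords, Matrix.det_fin_three, Fin.sum_univ_three]
  ring

theorem flags_interlace (g : V8 ≃ₗ[ℂ] V8)
    (y : ExteriorAlgebra ℂ V8) (hy : y = ExteriorAlgebra.map (g : V8 →ₗ[ℂ] V8) y4)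
    (V₂ V₅ : Submodule ℂ V8) (hV2 : Module.finrank ℂ V₂ = 2)
    (hV5 : Module.finrank ℂ V₅ = 5) (hV25 : V₂ ≤ V₅)
    (hyV : y ∈ wSpan V₅ V₅ V₅ ⊔ wSpan V₂ V₅ ⊤)
    (U₄ U₆ : Submodule ℂ V8) (hU4 : Module.finrank ℂ U₄ = 4)
    (hU6 : Module.finrank ℂ U₆ = 6) (hU46 : U₄ ≤ U₆)
    (hyU : y ∈ wSpan U₄ U₄ ⊤ ⊔ wSpan U₆ U₆ U₆) :
    V₂ ≤ U₄ ∧ U₄ ≤ V₅ ∧ V₅ ≤ U₆ := by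
  have hfin (W : Submodule ℂ V8) :
      Module.finrank ℂ W + Module.finrank ℂ W.dualAnnihilator = 8 := by
    simpa using Subspace.finrank_add_finrank_dualAnnihilator_eq W
  have hform : ∀ {S T U S' T' U' : Submodule ℂ V8} {α β γ : Module.Dual ℂ V8},
      y ∈ wSpan S T U ⊔ wSpan S' T' U' →
      (∀ s ∈ S, ∀ t ∈ T, ∀ u ∈ U,
        !![α s, α t, α u; β s, β t, β u; γ s, γ t, γ u].det = 0) →
      (∀ s ∈ S', ∀ t ∈ T', ∀ u ∈ U',
        !![α s, α t, α u; β s, β t, β u; γ s, γ t, γ u].det = 0) →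
      (y4Coords g).form α β γ = 0 := by
    intro S T U S' T' U' α β γ hmem h h'
    rw [← evalThree_map_y4, ← hy]
    exact sup_le (evalThree_eq_zero h) (evalThree_eq_zero h') hmem
  have hmem {W : Submodule ℂ V8} {α : Module.Dual ℂ V8} (hα : α ∈ W.dualAnnihilator) :
      ∀ w ∈ W, α w = 0 := (Submodule.mem_dualAnnihilator α).1 hα
  have hK3 : Module.finrank ℂ V₅.dualAnnihilator = 3 := by have := hfin V₅; omega
  have hL6 : Module.finrank ℂ V₂.dualAnnihilator = 6 := by have := hfin V₂; omega
  have hM4 : Module.finrank ℂ U₄.dualAnnihilator = 4 := by have := hfin U₄; omega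
  have hN2 : Module.finrank ℂ U₆.dualAnnihilator = 2 := by have := hfin U₆; omega
  have hNM : U₆.dualAnnihilator ≤ U₄.dualAnnihilator := Submodule.dualAnnihilator_anti hU46
  have hK : ∀ α ∈ V₅.dualAnnihilator, ∀ β ∈ V₅.dualAnnihilator, (y4Coords g).Contr α β := by
    refine fun α hα β hβ => AdaptedCoords.contr_of_form_eq_zero fun γ => hform hyV ?_ ?_
    · intro s hs t ht u hu
      simp [Matrix.det_fin_three, hmem hα _ hs, hmem hα _ ht, hmem hα _ hu]
    · intro s hs t ht u _
      simp [Matrix.det_fin_three, hmem hα _ (hV25 hs), hmem hα _ ht, hmem hβ _ (hV25 hs),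
        hmem hβ _ ht]
  have hL : ∀ α ∈ V₅.dualAnnihilator, ∀ β ∈ V₂.dualAnnihilator, ∀ γ ∈ V₂.dualAnnihilator,
      (y4Coords g).form α β γ = 0 := by
    refine fun α hα β hβ γ hγ => hform hyV ?_ ?_
    · intro s hs t ht u hu
      simp [Matrix.det_fin_three, hmem hα _ hs, hmem hα _ ht, hmem hα _ hu]
    · intro s hs t ht u _
      simp [Matrix.det_fin_three, hmem hα _ (hV25 hs), hmem hβ _ hs, hmem hγ _ hs]
  have hN : ∀ α ∈ U₆.dualAnnihilator, ∀ β ∈ U₄.dualAnnihilator, (y4Coords g).Contr α β := by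
    refine fun α hα β hβ => AdaptedCoords.contr_of_form_eq_zero fun γ => hform hyU ?_ ?_
    · intro s hs t ht u _
      simp [Matrix.det_fin_three, hmem hα _ (hU46 hs), hmem hα _ (hU46 ht), hmem hβ _ hs,
        hmem hβ _ ht]
    · intro s hs t ht u hu
      simp [Matrix.det_fin_three, hmem hα _ hs, hmem hα _ ht, hmem hα _ hu]
  have hM : ∀ α ∈ U₄.dualAnnihilator, ∀ β ∈ U₄.dualAnnihilator, ∀ γ ∈ U₄.dualAnnihilator,
      (y4Coords g).form α β γ = 0 := by
    refine fun α hα β hβ γ hγ => hform hyU ?_ ?_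
    · intro s hs t ht u _
      simp [Matrix.det_fin_three, hmem hα _ hs, hmem hβ _ hs, hmem hγ _ hs]
    · intro s hs t ht u hu
      exact det_eq_zero_of_mem_dualAnnihilator (by omega) hU46 hα hβ hγ hs ht hu
  have hmemK := AdaptedCoords.mem_iff_of_contr hK3 hL6 hK hL
  simp only [← Subspace.dualAnnihilator_le_dualAnnihilator_iff (W := U₄),
    ← Subspace.dualAnnihilator_le_dualAnnihilator_iff (W := V₅),
    ← Subspace.dualAnnihilator_le_dualAnnihilator_iff (W := U₆)]
  refine ⟨fun α hα => ?_, fun α hα => ?_, fun α hα => ?_⟩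
  · rw [AdaptedCoords.mem_iff_of_form_eq_zero hK3 hL6 hK hL]
    exact AdaptedCoords.c_eq_zero_of_mem_of_form_eq_zero hN2 hM4 hNM hN hM α hα
  · obtain ⟨hb, hc⟩ := (hmemK α).1 hα
    exact AdaptedCoords.mem_of_form_eq_zero hN2 hM4 hNM hN hM hb hc
  · rw [hmemK]
    exact ⟨AdaptedCoords.b_eq_zero_of_form_eq_zero hN2 hM4 hNM hN hM α hα,
      AdaptedCoords.c_eq_zero_of_form_eq_zero hM4 hN hM α hα⟩
end
end
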